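/- arXiv:math/0504568 — 6 statements merged into one kernel-verified Lean document; each statement's English description precedes it below -/
import Mathlib

section
/- (Triple mean value theorem) Let $f : \mathbb{R} \to \mathbb{R}$ be three times continuously differentiable. Then for all $\xi, \eta, \lambda, \gamma \in \mathbb{R}$, $|f(\xi+\eta+\lambda+\gamma) - f(\xi+\eta+\lambda) - f(\xi+\eta+\gamma) - f(\xi+\lambda+\gamma) + f(\xi+\eta) + f(\xi+\lambda) + f(\xi+\gamma) - f(\xi)| \le |\eta|\,|\lambda|\,|\gamma| \cdot \sup\{|f'''(\theta)| : |\theta - \xi| \le |\eta| + |\lambda| + |\gamma|\}$. -/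
theorem aux_mvt (g g' : ℝ → ℝ) (hg : ∀ x, HasDerivAt g (g' x) x) (x h C : ℝ)
    (hb : ∀ t, |t - x| ≤ |h| → |g' t| ≤ C) : |g (x + h) - g x| ≤ C * |h| := by
  have := (convex_closedBall x |h|).norm_image_sub_le_of_norm_hasDerivWithin_le
    (f := g) (f' := g') (C := C) (x := x) (y := x + h)
    (fun y _ => (hg y).hasDerivWithinAt)
    (fun y hy => hb y (by simpa [Real.dist_eq] using hy))
    (by simp) (by simp)
  simpa using this

theorem stmt_2 (f : ℝ → ℝ) (hf : ContDiff ℝ 3 f) (ξ η lam γ : ℝ) :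
    |f (ξ + η + lam + γ) - f (ξ + η + lam) - f (ξ + η + γ) - f (ξ + lam + γ)
        + f (ξ + η) + f (ξ + lam) + f (ξ + γ) - f ξ| ≤
      |η| * |lam| * |γ| *
        sSup ((fun θ => |iteratedDeriv 3 f θ|) ''
          Set.Icc (ξ - (|η| + |lam| + |γ|)) (ξ + (|η| + |lam| + |γ|))) := by
  set M := sSup ((fun θ => |iteratedDeriv 3 f θ|) ''
          Set.Icc (ξ - (|η| + |lam| + |γ|)) (ξ + (|η| + |lam| + |γ|))) with hM
  have hd : ∀ n : ℕ, n < 3 → ∀ x,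
      HasDerivAt (iteratedDeriv n f) (iteratedDeriv (n + 1) f x) x := by
    intro n hn x
    rw [iteratedDeriv_succ]
    exact ((hf.differentiable_iteratedDeriv n (by exact_mod_cast hn)) x).hasDerivAt
  have hc : Continuous (iteratedDeriv 3 f) := hf.continuous_iteratedDeriv 3 (by norm_num)
  have hbd : ∀ t, |t - ξ| ≤ |η| + |lam| + |γ| → |iteratedDeriv 3 f t| ≤ M := by
    intro t ht
    have h := abs_le.1 ht
    exact le_csSup (isCompact_Icc.image hc.abs).bddAbove
      ⟨t, ⟨by linarith [h.1], by linarith [h.2]⟩, rfl⟩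
  have hs : ∀ (n : ℕ), n < 3 → ∀ a x, HasDerivAt (fun y => iteratedDeriv n f (y + a))
      (iteratedDeriv (n + 1) f (x + a)) x := fun n hn a x => (hd n hn (x + a)).comp_add_const x a
  have h1 := aux_mvt
    (fun y => iteratedDeriv 0 f (y + (lam + γ)) - iteratedDeriv 0 f (y + lam)
      - (iteratedDeriv 0 f (y + γ) - iteratedDeriv 0 f y))
    (fun y => iteratedDeriv 1 f (y + (lam + γ)) - iteratedDeriv 1 f (y + lam)
      - (iteratedDeriv 1 f (y + γ) - iteratedDeriv 1 f y))
    (fun x => ((hs 0 (by norm_num) _ x).sub (hs 0 (by norm_num) _ x)).sub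
      ((hs 0 (by norm_num) _ x).sub (hd 0 (by norm_num) x))) ξ η (M * |γ| * |lam|) ?_
  · simp only [iteratedDeriv_zero] at h1
    calc _ = _ := by congr 1; ring_nf
      _ ≤ _ := h1
      _ = _ := by ring
  intro t ht
  have h2 := aux_mvt
    (fun y => iteratedDeriv 1 f (y + γ) - iteratedDeriv 1 f y)
    (fun y => iteratedDeriv 2 f (y + γ) - iteratedDeriv 2 f y)
    (fun x => (hs 1 (by norm_num) _ x).sub (hd 1 (by norm_num) x)) t lam (M * |γ|) ?_
  · calc _ = _ := by congr 1; ring_nf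
      _ ≤ _ := h2
  intro u hu
  refine aux_mvt _ _ (hd 2 (by norm_num)) u γ M ?_
  intro v hv
  apply hbd
  have e : v - ξ = (t - ξ) + (u - t) + (v - u) := by ring
  rw [e]
  exact (abs_add_three _ _ _).trans (by linarith)
end

section
/- (Improved bilinear Strichartz estimate for free Airy waves) Let $s > 1/4$ and $N \ge 1$. There exists a constant $C_s$ (depending only on $s$) such that the following holds. Let $F, G : \mathbb{R} \to \mathbb{C}$ be Schwartz functions with $\mathrm{supp}\, F \subseteq \{\xi : N \le |\xi| \le 2N\}$ and $\mathrm{supp}\, G \subseteq \{\xi : |\xi| \le N/100\}$, and define $v_1(x,t) = \int_{\mathbb{R}} e^{i(x\xi + t\xi^3)} F(\xi)\, d\xi$ and $v_2(x,t) = \int_{\mathbb{R}} e^{i(x\xi + t\xi^3)} G(\xi)\, d\xi$. Then $\Big( \int_{\mathbb{R}} \Big( \int_{\mathbb{R}} |v_1(x,t)\, v_2(x,t)|^2\, dt \Big)^{2} dx \Big)^{1/4} \le \frac{C_s}{N}\, \Big(\int_{\mathbb{R}} |F(\xi)|^2 d\xi\Big)^{1/2} \Big(\int_{\mathbb{R}}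 (1+\xi^2)^{s} |G(\xi)|^2 d\xi\Big)^{1/2}$. -/
open MeasureTheory Complex

lemma aux_gauss_step (μ : Measure ℝ) [SFinite μ] (φ : ℝ → ℝ) (hφ : Measurable φ) (g : ℝ → ℂ)
    (hgm : Measurable g) (hg : Integrable g μ) (M : ENNReal)
    (hM : ∀ b : ℝ, 0 < b → ∀ a : ℝ,
      ∫⁻ η, ENNReal.ofReal (√(Real.pi / b) * Real.exp (-(a - φ η) ^ 2 / (4 * b))) ∂μ ≤ M)
    (b : ℝ) (hb : 0 < b) :
    ∫⁻ t : ℝ, ‖∫ ξ, cexp (I * (t * φ ξ)) * g ξ ∂μ‖ₑ ^ 2 * ENNReal.ofReal (Real.exp (-b * t ^ 2))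
      ≤ M * ∫⁻ ξ, ‖g ξ‖ₑ ^ 2 ∂μ := by
  set V : ℝ → ℂ := fun t => ∫ ξ, cexp (I * (t * φ ξ)) * g ξ ∂μ with hV
  set H : ℝ → ℝ × ℝ → ℂ := fun t z => (cexp (I * (t * φ z.1)) * g z.1) *
    ((starRingEnd ℂ) (cexp (I * (t * φ z.2)) * g z.2)) * (Real.exp (-b * t ^ 2) : ℂ) with hH
  have hnorm : ∀ t a : ℝ, ‖cexp (I * (t * a))‖ = 1 := by
    intro t a
    rw [mul_comm, ← Complex.ofReal_mul]
    exact Complex.norm_exp_ofReal_mul_I _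
  have hHint : Integrable (Function.uncurry H) (volume.prod (μ.prod μ)) := by
    have h1 : Integrable (fun p : ℝ × (ℝ × ℝ) => Real.exp (-b * p.1 ^ 2) * (‖g p.2.1‖ * ‖g p.2.2‖))
        (volume.prod (μ.prod μ)) :=
      Integrable.mul_prod (f := fun t : ℝ => Real.exp (-b * t ^ 2))
        (g := fun z : ℝ × ℝ => ‖g z.1‖ * ‖g z.2‖) (integrable_exp_neg_mul_sq hb)
        (Integrable.mul_prod hg.norm hg.norm)
    refine h1.mono' ?_ ?_
    · apply Measurable.aestronglyMeasurable
      simp only [hH, Function.uncurry_def]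
      have : Measurable (starRingEnd ℂ : ℂ → ℂ) := Complex.continuous_conj.measurable
      fun_prop
    · refine Filter.Eventually.of_forall fun p => ?_
      simp only [hH, Function.uncurry_def, norm_mul, hnorm, RCLike.norm_conj, one_mul]
      rw [Complex.norm_real, Real.norm_of_nonneg (Real.exp_pos _).le, mul_comm]
  have hinner : ∀ t, ∫ z, H t z ∂(μ.prod μ) = ((‖V t‖ ^ 2 * Real.exp (-b * t ^ 2) : ℝ) : ℂ) := by
    intro t
    simp only [hH]
    rw [integral_mul_const, integral_prod_mul (fun ξ => cexp (I * (t * φ ξ)) * g ξ)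
      (fun ξ => (starRingEnd ℂ) (cexp (I * (t * φ ξ)) * g ξ)), integral_conj]
    rw [Complex.mul_conj, Complex.normSq_eq_norm_sq]
    push_cast
    rfl
  have hint2 : Integrable (fun t => ∫ z, H t z ∂(μ.prod μ)) := hHint.integral_prod_left
  have hgau : ∀ z : ℝ × ℝ, ∫ t, H t z = g z.1 * (starRingEnd ℂ) (g z.2) *
      ((√(Real.pi / b) * Real.exp (-(φ z.1 - φ z.2) ^ 2 / (4 * b)) : ℝ) : ℂ) := by
    intro z
    have h := fourierIntegral_gaussian (b := (b : ℂ)) (by simpa using hb) ((φ z.1 - φ z.2 : ℝ) : ℂ)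
    have h2 : ∀ t : ℝ, H t z = g z.1 * (starRingEnd ℂ) (g z.2) *
        (cexp (I * ((φ z.1 - φ z.2 : ℝ) : ℂ) * t) * cexp (-(b : ℂ) * (t : ℂ) ^ 2)) := by
      intro t
      simp only [hH, map_mul, ← Complex.exp_conj, Complex.conj_I, Complex.conj_ofReal]
      have : cexp (I * ((φ z.1 - φ z.2 : ℝ) : ℂ) * t) =
          cexp (I * (t * φ z.1)) * cexp (-I * (t * φ z.2)) := by
        rw [← Complex.exp_add]; congr 1; push_cast; ring
      rw [this]; push_cast; ring
    simp_rw [h2]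
    rw [integral_const_mul, h]
    congr 1
    rw [Complex.ofReal_mul, Real.sqrt_eq_rpow, Complex.ofReal_cpow (by positivity)]
    push_cast; rfl
  have e1 : ∀ t, ‖V t‖ₑ ^ 2 * ENNReal.ofReal (Real.exp (-b * t ^ 2)) =
      ‖∫ z, H t z ∂(μ.prod μ)‖ₑ := by
    intro t
    rw [hinner, ← ofReal_norm, ← ofReal_norm, Complex.norm_real,
      Real.norm_of_nonneg (by positivity), ENNReal.ofReal_mul (by positivity), ENNReal.ofReal_pow (norm_nonneg _)]
  have e2 : ∫⁻ t, ‖∫ z, H t z ∂(μ.prod μ)‖ₑ = ‖∫ t, ∫ z, H t z ∂(μ.prod μ)‖ₑ := by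
    rw [← ofReal_integral_norm_eq_lintegral_enorm hint2, ← ofReal_norm]
    congr 1
    simp_rw [hinner]
    rw [integral_complex_ofReal, Complex.norm_real, Real.norm_of_nonneg]
    · congr 1; ext t
      rw [Complex.norm_real, Real.norm_of_nonneg (by positivity)]
    · exact integral_nonneg fun t => by positivity
  set k : ℝ → ℝ → ENNReal := fun x y =>
    ENNReal.ofReal (√(Real.pi / b) * Real.exp (-(φ x - φ y) ^ 2 / (4 * b))) with hk
  have hkm : Measurable (Function.uncurry k) := by
    simp only [hk, Function.uncurry_def]; fun_prop
  have hks : ∀ x y, k x y = k y x := by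
    intro x y; simp only [hk]; congr 3; ring
  have hkM : ∀ x, ∫⁻ y, k x y ∂μ ≤ M := fun x => hM b hb (φ x)
  calc _ = ∫⁻ t, ‖∫ z, H t z ∂(μ.prod μ)‖ₑ := lintegral_congr e1
    _ = ‖∫ t, ∫ z, H t z ∂(μ.prod μ)‖ₑ := e2
    _ = ‖∫ z, (∫ t, H t z) ∂(μ.prod μ)‖ₑ := by rw [integral_integral_swap hHint]
    _ ≤ ∫⁻ z, ‖∫ t, H t z‖ₑ ∂(μ.prod μ) := enorm_integral_le_lintegral_enorm _
    _ = ∫⁻ z : ℝ × ℝ, ‖g z.1‖ₑ * ‖g z.2‖ₑ * k z.1 z.2 ∂(μ.prod μ) := by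
        refine lintegral_congr fun z => ?_
        rw [hgau, enorm_mul, enorm_mul, RCLike.enorm_conj]
        congr 1
        rw [← ofReal_norm, Complex.norm_real, Real.norm_of_nonneg (by positivity)]
    _ ≤ ∫⁻ z : ℝ × ℝ, (2⁻¹ * (‖g z.1‖ₑ ^ 2 * k z.1 z.2) + 2⁻¹ * (‖g z.2‖ₑ ^ 2 * k z.1 z.2)) ∂(μ.prod μ) := by
        refine lintegral_mono fun z => ?_
        have : ‖g z.1‖ₑ * ‖g z.2‖ₑ ≤ 2⁻¹ * (‖g z.1‖ₑ ^ 2 + ‖g z.2‖ₑ ^ 2) := by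
          rw [← ofReal_norm, ← ofReal_norm, ← ENNReal.ofReal_mul (norm_nonneg _),
            ← ENNReal.ofReal_pow (norm_nonneg _), ← ENNReal.ofReal_pow (norm_nonneg _),
            ← ENNReal.ofReal_add (by positivity) (by positivity)]
          have : (2⁻¹ : ENNReal) = ENNReal.ofReal (2⁻¹) := by
            rw [ENNReal.ofReal_inv_of_pos (by norm_num)]; simp
          rw [this, ← ENNReal.ofReal_mul (by norm_num)]
          apply ENNReal.ofReal_le_ofReal
          nlinarith [sq_nonneg (‖g z.1‖ - ‖g z.2‖)]
        calc _ ≤ (2⁻¹ * (‖g z.1‖ₑ ^ 2 + ‖g z.2‖ₑ ^ 2)) * k z.1 z.2 := by gcongr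
          _ = _ := by ring
    _ = 2⁻¹ * ∫⁻ x, ∫⁻ y, ‖g x‖ₑ ^ 2 * k x y ∂μ ∂μ + 2⁻¹ * ∫⁻ x, ∫⁻ y, ‖g y‖ₑ ^ 2 * k x y ∂μ ∂μ := by
        have hkm' : Measurable (fun z : ℝ × ℝ => k z.1 z.2) := hkm
        rw [lintegral_add_left (by fun_prop), lintegral_const_mul _ (by fun_prop),
          lintegral_const_mul _ (by fun_prop), lintegral_prod _ (by fun_prop), lintegral_prod _ (by fun_prop)]
    _ = 2⁻¹ * ∫⁻ x, ∫⁻ y, ‖g x‖ₑ ^ 2 * k x y ∂μ ∂μ + 2⁻¹ * ∫⁻ x, ∫⁻ y, ‖g x‖ₑ ^ 2 * k x y ∂μ ∂μ := by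
        congr 2
        rw [lintegral_lintegral_swap]
        · simp_rw [hks]
        · have hkm' : Measurable (fun z : ℝ × ℝ => k z.1 z.2) := hkm
          simp only [Function.uncurry_def]
          fun_prop
    _ = ∫⁻ x, ∫⁻ y, ‖g x‖ₑ ^ 2 * k x y ∂μ ∂μ := by
        rw [← add_mul, ENNReal.inv_two_add_inv_two, one_mul]
    _ ≤ ∫⁻ x, ‖g x‖ₑ ^ 2 * M ∂μ := by
        refine lintegral_mono fun x => ?_
        simp only
        rw [lintegral_const_mul _ (hkm.of_uncurry_left)]
        gcongr
        exact hkM x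
    _ = _ := by rw [lintegral_mul_const _ (by fun_prop), mul_comm]

lemma aux_planch (μ : Measure ℝ) [SFinite μ] (φ : ℝ → ℝ) (hφ : Measurable φ) (g : ℝ → ℂ)
    (hgm : Measurable g) (hg : Integrable g μ) (M : ENNReal)
    (hM : ∀ b : ℝ, 0 < b → ∀ a : ℝ,
      ∫⁻ η, ENNReal.ofReal (√(Real.pi / b) * Real.exp (-(a - φ η) ^ 2 / (4 * b))) ∂μ ≤ M) :
    ∫⁻ t : ℝ, ‖∫ ξ, cexp (I * (t * φ ξ)) * g ξ ∂μ‖ₑ ^ 2 ≤ M * ∫⁻ ξ, ‖g ξ‖ₑ ^ 2 ∂μ := by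
  have hVm : Measurable (fun t : ℝ => ∫ ξ, cexp (I * (t * φ ξ)) * g ξ ∂μ) := by
    refine (StronglyMeasurable.integral_prod_right (f := fun (t : ℝ) ξ => cexp (I * (t * φ ξ)) * g ξ) ?_).measurable
    apply Measurable.stronglyMeasurable
    simp only [Function.uncurry_def]; fun_prop
  have key : Filter.Tendsto (fun n : ℕ => ∫⁻ t : ℝ, ‖∫ ξ, cexp (I * (t * φ ξ)) * g ξ ∂μ‖ₑ ^ 2 *
      ENNReal.ofReal (Real.exp (-(1 / ((n : ℝ) + 1)) * t ^ 2))) Filter.atTop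
      (nhds (∫⁻ t : ℝ, ‖∫ ξ, cexp (I * (t * φ ξ)) * g ξ ∂μ‖ₑ ^ 2)) := by
    apply lintegral_tendsto_of_tendsto_of_monotone
    · intro n; fun_prop
    · refine Filter.Eventually.of_forall fun t n m hnm => ?_
      simp only
      gcongr
    · refine Filter.Eventually.of_forall fun t => ?_
      have h0 : Filter.Tendsto (fun n : ℕ => Real.exp (-(1 / ((n : ℝ) + 1)) * t ^ 2)) Filter.atTop (nhds (Real.exp (-0 * t ^ 2))) :=
        (Real.continuous_exp.tendsto _).comp ((tendsto_one_div_add_atTop_nhds_zero_nat.neg).mul_const _)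
      have h1 := ENNReal.tendsto_ofReal h0
      have h2 := ENNReal.Tendsto.const_mul (a := ‖∫ ξ, cexp (I * (t * φ ξ)) * g ξ ∂μ‖ₑ ^ 2) h1 (Or.inl (by simp))
      simpa using h2
  exact le_of_tendsto' key fun n => aux_gauss_step μ φ hφ g hgm hg M hM _ (by positivity)

lemma aux_osc (S : Set ℝ) (hS : MeasurableSet S) (φ φ' : ℝ → ℝ) (hφ : Measurable φ)
    (hd : ∀ x ∈ S, HasDerivAt φ (φ' x) x) (hinj : Set.InjOn φ S) (c : ℝ) (hc : 0 < c)
    (hlb : ∀ x ∈ S, c ≤ |φ' x|) (g : ℝ → ℂ) (hgm : Measurable g) (hg : Integrable g)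
    (hsupp : ∀ x, x ∉ S → g x = 0) :
    ∫⁻ t : ℝ, ‖∫ ξ, cexp (I * (t * φ ξ)) * g ξ‖ₑ ^ 2
      ≤ ENNReal.ofReal (2 * Real.pi / c) * ∫⁻ ξ, ‖g ξ‖ₑ ^ 2 := by
  have h := aux_planch (volume.restrict S) φ hφ g hgm hg.restrict (ENNReal.ofReal (2 * Real.pi / c)) ?_
  · have e : ∀ t : ℝ, ∫ ξ in S, cexp (I * (t * φ ξ)) * g ξ = ∫ ξ, cexp (I * (t * φ ξ)) * g ξ := fun t =>
      setIntegral_eq_integral_of_forall_compl_eq_zero fun x hx => by rw [hsupp x hx, mul_zero]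
    simp_rw [e] at h
    refine h.trans ?_
    gcongr
    exact Measure.restrict_le_self
  · intro b hb a
    set k : ℝ → ENNReal := fun τ => ENNReal.ofReal (√(Real.pi / b) * Real.exp (-(a - τ) ^ 2 / (4 * b))) with hk
    have hkm : Measurable k := by simp only [hk]; fun_prop
    calc ∫⁻ η in S, k (φ η) ≤ ∫⁻ η in S, ENNReal.ofReal (1 / c) * (ENNReal.ofReal |φ' η| * k (φ η)) := by
          refine setLIntegral_mono' hS fun x hx => ?_
          rw [← mul_assoc, ← ENNReal.ofReal_mul (by positivity)]
          have : 1 ≤ ENNReal.ofReal (1 / c * |φ' x|) := by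
            rw [ENNReal.one_le_ofReal, one_div, inv_mul_eq_div, le_div_iff₀ hc]
            simpa using hlb x hx
          calc k (φ x) = 1 * k (φ x) := (one_mul _).symm
            _ ≤ _ := by gcongr
      _ = ENNReal.ofReal (1 / c) * ∫⁻ τ in φ '' S, k τ := by
          rw [lintegral_const_mul' _ _ (by simp),
            lintegral_image_eq_lintegral_abs_deriv_mul hS (fun x hx => (hd x hx).hasDerivWithinAt) hinj]
      _ ≤ ENNReal.ofReal (1 / c) * ∫⁻ τ, k τ := by
          gcongr
          exact Measure.restrict_le_self
      _ = ENNReal.ofReal (2 * Real.pi / c) := by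
          have e1 : ∫⁻ τ, k τ = ENNReal.ofReal (2 * Real.pi) := by
            rw [← lintegral_sub_left_eq_self k a]
            simp only [hk, sub_sub_cancel]
            have hi : Integrable (fun τ : ℝ => √(Real.pi / b) * Real.exp (-τ ^ 2 / (4 * b))) := by
              have := (integrable_exp_neg_mul_sq (b := 1 / (4 * b)) (by positivity)).const_mul (√(Real.pi / b))
              refine this.congr (Filter.Eventually.of_forall fun x => ?_)
              simp only; congr 2; ring
            rw [← ofReal_integral_eq_lintegral_ofReal hi (Filter.Eventually.of_forall fun x => by positivity)]
            congr 1
            rw [integral_const_mul]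
            have := integral_gaussian (1 / (4 * b))
            have e : ∀ x : ℝ, -x ^ 2 / (4 * b) = -(1 / (4 * b)) * x ^ 2 := fun x => by ring
            simp_rw [e]
            rw [this, ← Real.sqrt_mul (by positivity)]
            rw [Real.sqrt_eq_iff_mul_self_eq (by positivity) (by positivity)]
            field_simp
            ring
          rw [e1, ← ENNReal.ofReal_mul (by positivity)]
          congr 1; ring

noncomputable def airyV (F : ℝ → ℂ) (x t : ℝ) : ℂ :=
  ∫ ξ : ℝ, cexp (I * (x * ξ + t * ξ ^ 3)) * F ξ

lemma aux_norm_exp (θ : ℂ) (h : θ.im = 0) : ‖cexp (I * θ)‖ = 1 := by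
  have : θ = (θ.re : ℂ) := by apply Complex.ext <;> simp [h]
  rw [this, mul_comm]
  exact Complex.norm_exp_ofReal_mul_I _

lemma aux_norm_exp' (x t ξ : ℝ) : ‖cexp (I * (x * ξ + t * ξ ^ 3))‖ = 1 := by
  apply aux_norm_exp
  have : ((x : ℂ) * ξ + t * ξ ^ 3) = ((x * ξ + t * ξ ^ 3 : ℝ) : ℂ) := by push_cast; rfl
  rw [this]; exact Complex.ofReal_im _

lemma aux_int_exp (x t : ℝ) (F : ℝ → ℂ) (hF : Integrable F) :
    Integrable (fun ξ : ℝ => cexp (I * (x * ξ + t * ξ ^ 3)) * F ξ) := by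
  refine hF.bdd_mul (c := 1) ?_ ?_
  · apply Measurable.aestronglyMeasurable; fun_prop
  · exact Filter.Eventually.of_forall fun ξ => (aux_norm_exp' x t ξ).le

lemma airyV_meas (F : ℝ → ℂ) (hFm : Measurable F) :
    Measurable (fun p : ℝ × ℝ => airyV F p.1 p.2) := by
  refine (StronglyMeasurable.integral_prod_right
    (f := fun (p : ℝ × ℝ) (ξ : ℝ) => cexp (I * (p.1 * ξ + p.2 * ξ ^ 3)) * F ξ) ?_).measurable
  apply Measurable.stronglyMeasurable
  simp only [Function.uncurry_def]; fun_prop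

lemma airy_smoothing (N : ℝ) (hN : 1 ≤ N) (F : ℝ → ℂ) (hFm : Measurable F) (hF : Integrable F)
    (hs : ∀ ξ, F ξ ≠ 0 → N ≤ |ξ|) (x : ℝ) :
    ∫⁻ t : ℝ, ‖airyV F x t‖ₑ ^ 2 ≤ ENNReal.ofReal (2 * Real.pi / N ^ 2) * ∫⁻ ξ, ‖F ξ‖ₑ ^ 2 := by
  have hnx : ∀ ξ : ℝ, ‖cexp (I * (x * ξ))‖ = 1 := fun ξ => by
    have := aux_norm_exp' x 0 ξ
    simpa using this
  have h := aux_osc {ξ : ℝ | N ≤ |ξ|} (measurableSet_le measurable_const (by fun_prop))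
    (fun ξ => ξ ^ 3) (fun ξ => 3 * ξ ^ 2) (by fun_prop)
    (fun ξ _ => by simpa using hasDerivAt_pow 3 ξ)
    ((Odd.strictMono_pow (by decide)).injective.injOn) (N ^ 2) (by positivity)
    (fun ξ hξ => by
      rw [Set.mem_ofPred_eq] at hξ
      rw [abs_of_nonneg (by positivity), ← sq_abs ξ]
      nlinarith)
    (fun ξ => cexp (I * (x * ξ)) * F ξ) (by fun_prop)
    (hF.bdd_mul (c := 1) (by apply Measurable.aestronglyMeasurable; fun_prop)
      (Filter.Eventually.of_forall fun ξ => (hnx ξ).le))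
    (fun ξ hξ => by
      by_contra h
      exact hξ (hs ξ (right_ne_zero_of_mul h)))
  have e1 : ∀ t : ℝ, ∫ ξ : ℝ, cexp (I * (t * ((ξ ^ 3 : ℝ) : ℂ))) * (cexp (I * (x * ξ)) * F ξ) = airyV F x t := by
    intro t
    unfold airyV
    congr 1; ext ξ
    rw [← mul_assoc, ← Complex.exp_add]
    congr 2; push_cast; ring
  have e2 : ∀ ξ : ℝ, ‖cexp (I * (x * ξ)) * F ξ‖ₑ = ‖F ξ‖ₑ := by
    intro ξ
    rw [enorm_mul, ← ofReal_norm, hnx]; simp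
  simp_rw [e1, e2] at h
  exact h

lemma airy_bilinear (N : ℝ) (hN : 1 ≤ N) (F G : ℝ → ℂ) (hFm : Measurable F) (hF : Integrable F)
    (hGm : Measurable G) (hG : Integrable G)
    (hFs : ∀ ξ, F ξ ≠ 0 → N ≤ |ξ|) (hGs : ∀ ξ, G ξ ≠ 0 → |ξ| ≤ N / 100) :
    ∫⁻ x : ℝ, ∫⁻ t : ℝ, ‖airyV F x t * airyV G x t‖ₑ ^ 2 ≤
      ENNReal.ofReal (2 * Real.pi) * (ENNReal.ofReal (2 * Real.pi / N ^ 2) *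
        ((∫⁻ ξ, ‖F ξ‖ₑ ^ 2) * ∫⁻ ξ, ‖G ξ‖ₑ ^ 2)) := by
  set W : ℝ → ℝ → ℂ := fun u t => ∫ ξ : ℝ, cexp (I * (t * ((ξ ^ 3 + (u - ξ) ^ 3 : ℝ) : ℂ))) * (F ξ * G (u - ξ)) with hW
  have hWm : Measurable (fun p : ℝ × ℝ => W p.1 p.2) := by
    refine (StronglyMeasurable.integral_prod_right
      (f := fun (p : ℝ × ℝ) (ξ : ℝ) => cexp (I * (p.2 * ((ξ ^ 3 + (p.1 - ξ) ^ 3 : ℝ) : ℂ))) * (F ξ * G (p.1 - ξ))) ?_).measurable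
    apply Measurable.stronglyMeasurable
    simp only [Function.uncurry_def]; fun_prop
  have hFG : Integrable (fun p : ℝ × ℝ => F p.2 * G (p.1 - p.2)) (volume.prod volume) :=
    Integrable.convolution_integrand (ContinuousLinearMap.mul ℝ ℂ) hF hG
  have hWint : ∀ t, Integrable (fun u => W u t) := by
    intro t
    have : Integrable (fun p : ℝ × ℝ => cexp (I * (t * ((p.2 ^ 3 + (p.1 - p.2) ^ 3 : ℝ) : ℂ))) * (F p.2 * G (p.1 - p.2))) (volume.prod volume) := by
      refine hFG.bdd_mul (c := 1) ?_ ?_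
      · apply Measurable.aestronglyMeasurable; fun_prop
      · refine Filter.Eventually.of_forall fun p => (aux_norm_exp _ ?_).le
        rw [← Complex.ofReal_mul]; exact Complex.ofReal_im _
    exact this.integral_prod_left
  have hprod : ∀ x t : ℝ, airyV F x t * airyV G x t = ∫ u : ℝ, cexp (I * (x * u)) * W u t := by
    intro x t
    have h := integral_convolution (μ := volume) (ν := volume) (ContinuousLinearMap.mul ℝ ℂ) (aux_int_exp x t F hF) (aux_int_exp x t G hG)
    simp only [ContinuousLinearMap.mul_apply'] at h
    unfold airyV
    rw [← h]
    congr 1; ext u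
    simp only [hW, convolution_def, ContinuousLinearMap.mul_apply']
    rw [← integral_const_mul]
    congr 1; ext ξ
    have : cexp (I * (x * u)) * cexp (I * (t * ((ξ ^ 3 + (u - ξ) ^ 3 : ℝ) : ℂ))) =
      cexp (I * (x * ξ + t * ξ ^ 3)) * cexp (I * (x * ((u - ξ : ℝ) : ℂ) + t * ((u - ξ : ℝ) : ℂ) ^ 3)) := by
      rw [← Complex.exp_add, ← Complex.exp_add]
      congr 1; push_cast; ring
    linear_combination (-(F ξ * G (u - ξ))) * this
  have hx : ∀ t : ℝ, ∫⁻ x : ℝ, ‖airyV F x t * airyV G x t‖ₑ ^ 2 ≤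
      ENNReal.ofReal (2 * Real.pi) * ∫⁻ u, ‖W u t‖ₑ ^ 2 := by
    intro t
    have h := aux_osc Set.univ MeasurableSet.univ (fun u => u) (fun _ => 1) measurable_id
      (fun u _ => hasDerivAt_id u) (Function.injective_id.injOn) 1 one_pos (fun _ _ => by simp)
      (fun u => W u t) (hWm.comp (f := fun u : ℝ => (u, t)) (by fun_prop)) (hWint t) (fun x hx => absurd (Set.mem_univ x) hx)
    simp_rw [hprod]
    simpa using h
  have ht : ∀ᵐ u : ℝ, ∫⁻ t : ℝ, ‖W u t‖ₑ ^ 2 ≤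
      ENNReal.ofReal (2 * Real.pi / N ^ 2) * ∫⁻ ξ, ‖F ξ * G (u - ξ)‖ₑ ^ 2 := by
    filter_upwards [hFG.prod_right_ae] with u hu
    refine aux_osc {ξ : ℝ | N ≤ |ξ| ∧ |u - ξ| ≤ N / 100} ?_ (fun ξ => ξ ^ 3 + (u - ξ) ^ 3)
      (fun ξ => 3 * ξ ^ 2 - 3 * (u - ξ) ^ 2) (by fun_prop) ?_ ?_ (N ^ 2) (by positivity) ?_
      (fun ξ => F ξ * G (u - ξ)) (by fun_prop) hu ?_
    · have m1 : MeasurableSet {ξ : ℝ | N ≤ |ξ|} := measurableSet_le measurable_const (by fun_prop)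
      have m2 : MeasurableSet {ξ : ℝ | |u - ξ| ≤ N / 100} := measurableSet_le (by fun_prop) measurable_const
      exact m1.inter m2
    · intro ξ _
      have h1 := hasDerivAt_pow 3 ξ
      have h2 := ((hasDerivAt_id ξ).const_sub u).pow 3
      have := h1.add h2
      refine this.congr_deriv ?_
      simp [sub_eq_add_neg]
    · rintro ξ ⟨h1, h2⟩ η ⟨h3, h4⟩ h
      have h5 : u * ((ξ - η) * (ξ + η - u)) = 0 := by linear_combination h / 3
      have hu0 : u ≠ 0 := by
        rintro rfl
        rw [zero_sub, abs_neg] at h2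
        linarith
      rcases mul_eq_zero.mp ((mul_eq_zero.mp h5).resolve_left hu0) with h6 | h6
      · linarith
      · have : u - ξ = η := by linarith
        rw [this] at h2
        linarith
    · rintro ξ ⟨h1, h2⟩
      have h3 : N ^ 2 ≤ ξ ^ 2 := by rw [← sq_abs ξ]; gcongr
      have h4 : (u - ξ) ^ 2 ≤ (N / 100) ^ 2 := by rw [← sq_abs (u - ξ)]; gcongr
      refine le_trans ?_ (le_abs_self _)
      nlinarith
    · intro ξ hξ
      by_contra h
      exact hξ ⟨hFs ξ (left_ne_zero_of_mul h), hGs _ (right_ne_zero_of_mul h)⟩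
  have hVFm := airyV_meas F hFm
  have hVGm := airyV_meas G hGm
  calc ∫⁻ x : ℝ, ∫⁻ t : ℝ, ‖airyV F x t * airyV G x t‖ₑ ^ 2
      = ∫⁻ t : ℝ, ∫⁻ x : ℝ, ‖airyV F x t * airyV G x t‖ₑ ^ 2 := by
        apply lintegral_lintegral_swap
        simp only [Function.uncurry_def]
        fun_prop
    _ ≤ ∫⁻ t : ℝ, ENNReal.ofReal (2 * Real.pi) * ∫⁻ u, ‖W u t‖ₑ ^ 2 := lintegral_mono hx
    _ = ENNReal.ofReal (2 * Real.pi) * ∫⁻ u, ∫⁻ t : ℝ, ‖W u t‖ₑ ^ 2 := by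
        rw [lintegral_const_mul' _ _ (by finiteness), lintegral_lintegral_swap]
        have : Measurable (fun p : ℝ × ℝ => W p.2 p.1) := hWm.comp (f := Prod.swap) measurable_swap
        simp only [Function.uncurry_def]
        fun_prop
    _ ≤ ENNReal.ofReal (2 * Real.pi) * ∫⁻ u, ENNReal.ofReal (2 * Real.pi / N ^ 2) * ∫⁻ ξ, ‖F ξ * G (u - ξ)‖ₑ ^ 2 := by
        exact mul_le_mul' le_rfl (lintegral_mono_ae ht)
    _ = _ := by
        rw [lintegral_const_mul' _ _ (by finiteness), lintegral_lintegral_swap]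
        · congr 2
          have : ∀ ξ : ℝ, ∫⁻ u : ℝ, ‖F ξ * G (u - ξ)‖ₑ ^ 2 = ‖F ξ‖ₑ ^ 2 * ∫⁻ u, ‖G u‖ₑ ^ 2 := by
            intro ξ
            simp_rw [enorm_mul, mul_pow]
            rw [lintegral_const_mul' _ _ (by finiteness), lintegral_sub_right_eq_self (fun u => ‖G u‖ₑ ^ 2) ξ]
          simp_rw [this]
          rw [lintegral_mul_const _ (by fun_prop)]
        · simp only [Function.uncurry_def]
          fun_prop

lemma aux_cs (D : Set ℝ) (f : ℝ → ENNReal) (hf : Measurable f) :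
    (∫⁻ ξ in D, f ξ) ^ 2 ≤ volume D * ∫⁻ ξ in D, f ξ ^ 2 := by
  have h := ENNReal.lintegral_mul_le_Lp_mul_Lq (volume.restrict D) Real.HolderConjugate.two_two
    (f := fun _ => 1) (g := f) aemeasurable_const hf.aemeasurable
  simp only [Pi.mul_apply, one_mul, one_pow, lintegral_const, Measure.restrict_apply_univ, ENNReal.rpow_two] at h
  calc _ ≤ (volume D ^ (1 / 2 : ℝ) * (∫⁻ ξ in D, f ξ ^ 2) ^ (1 / 2 : ℝ)) ^ 2 := by gcongr
    _ = _ := by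
      rw [mul_pow, ← ENNReal.rpow_natCast, ← ENNReal.rpow_natCast, ← ENNReal.rpow_mul, ← ENNReal.rpow_mul]
      norm_num

lemma airy_piece (N : ℝ) (hN : 1 ≤ N) (F G : ℝ → ℂ) (hFm : Measurable F) (hF : Integrable F)
    (hGm : Measurable G) (hG : Integrable G)
    (hFs : ∀ ξ, F ξ ≠ 0 → N ≤ |ξ|) (hGs : ∀ ξ, G ξ ≠ 0 → |ξ| ≤ N / 100)
    (R : ℝ) (hR : ∀ ξ, G ξ ≠ 0 → |ξ| ≤ R) :
    ∫⁻ x : ℝ, (∫⁻ t : ℝ, ‖airyV F x t * airyV G x t‖ₑ ^ 2) ^ 2 ≤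
      ENNReal.ofReal (2 * Real.pi * (2 * Real.pi / N ^ 2) ^ 2 * (2 * R)) *
        ((∫⁻ ξ, ‖F ξ‖ₑ ^ 2) * ∫⁻ ξ, ‖G ξ‖ₑ ^ 2) ^ 2 := by
  have hsup : ∀ x t : ℝ, ‖airyV G x t‖ₑ ^ 2 ≤ ENNReal.ofReal (2 * R) * ∫⁻ ξ, ‖G ξ‖ₑ ^ 2 := by
    intro x t
    have h1 : ‖airyV G x t‖ₑ ≤ ∫⁻ ξ in Set.Icc (-R) R, ‖G ξ‖ₑ := by
      have e : airyV G x t = ∫ ξ in Set.Icc (-R) R, cexp (I * (x * ξ + t * ξ ^ 3)) * G ξ := by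
        symm
        refine setIntegral_eq_integral_of_forall_compl_eq_zero fun ξ hξ => ?_
        by_contra h
        exact hξ (abs_le.mp (hR ξ (right_ne_zero_of_mul h)))
      rw [e]
      refine (enorm_integral_le_lintegral_enorm _).trans (lintegral_mono fun ξ => ?_)
      rw [enorm_mul, ← ofReal_norm, aux_norm_exp']; simp
    calc _ ≤ (∫⁻ ξ in Set.Icc (-R) R, ‖G ξ‖ₑ) ^ 2 := by gcongr
      _ ≤ _ := aux_cs _ _ (by fun_prop)
      _ ≤ _ := by
        rw [Real.volume_Icc, show R - -R = 2 * R by ring]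
        gcongr
        exact Measure.restrict_le_self
  set f := ∫⁻ ξ, ‖F ξ‖ₑ ^ 2
  set g := ∫⁻ ξ, ‖G ξ‖ₑ ^ 2
  have hA : ∀ x : ℝ, ∫⁻ t : ℝ, ‖airyV F x t * airyV G x t‖ₑ ^ 2 ≤
      (ENNReal.ofReal (2 * Real.pi / N ^ 2) * f) * (ENNReal.ofReal (2 * R) * g) := by
    intro x
    have hm : Measurable (fun t => airyV F x t) := (airyV_meas F hFm).comp (f := fun t : ℝ => (x, t)) (by fun_prop)
    calc _ ≤ ∫⁻ t : ℝ, ‖airyV F x t‖ₑ ^ 2 * (ENNReal.ofReal (2 * R) * g) := by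
          refine lintegral_mono fun t => ?_
          rw [enorm_mul, mul_pow]
          gcongr
          exact hsup x t
      _ = (∫⁻ t : ℝ, ‖airyV F x t‖ₑ ^ 2) * (ENNReal.ofReal (2 * R) * g) := lintegral_mul_const _ (by fun_prop)
      _ ≤ _ := by
        gcongr
        exact airy_smoothing N hN F hFm hF hFs x
  have hmA : Measurable (fun x : ℝ => ∫⁻ t : ℝ, ‖airyV F x t * airyV G x t‖ₑ ^ 2) := by
    have h1 := airyV_meas F hFm
    have h2 := airyV_meas G hGm
    refine Measurable.lintegral_prod_right' (f := fun p : ℝ × ℝ => ‖airyV F p.1 p.2 * airyV G p.1 p.2‖ₑ ^ 2) ?_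
    fun_prop
  calc _ ≤ ∫⁻ x : ℝ, ((ENNReal.ofReal (2 * Real.pi / N ^ 2) * f) * (ENNReal.ofReal (2 * R) * g)) *
        ∫⁻ t : ℝ, ‖airyV F x t * airyV G x t‖ₑ ^ 2 := by
        refine lintegral_mono fun x => ?_
        rw [sq]
        gcongr
        exact hA x
    _ = ((ENNReal.ofReal (2 * Real.pi / N ^ 2) * f) * (ENNReal.ofReal (2 * R) * g)) *
        ∫⁻ x : ℝ, ∫⁻ t : ℝ, ‖airyV F x t * airyV G x t‖ₑ ^ 2 := lintegral_const_mul _ hmA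
    _ ≤ ((ENNReal.ofReal (2 * Real.pi / N ^ 2) * f) * (ENNReal.ofReal (2 * R) * g)) *
        (ENNReal.ofReal (2 * Real.pi) * (ENNReal.ofReal (2 * Real.pi / N ^ 2) * (f * g))) := by
        gcongr
        exact airy_bilinear N hN F G hFm hF hGm hG hFs hGs
    _ = _ := by
        have : ENNReal.ofReal (2 * Real.pi * (2 * Real.pi / N ^ 2) ^ 2 * (2 * R)) =
            ENNReal.ofReal (2 * Real.pi) * ENNReal.ofReal (2 * Real.pi / N ^ 2) ^ 2 * ENNReal.ofReal (2 * R) := by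
          rw [ENNReal.ofReal_mul (by positivity), ENNReal.ofReal_mul (by positivity), ENNReal.ofReal_pow (by positivity)]
        rw [this]
        ring

lemma aux_cs_sum (β : ℝ) (hβ : 1 < β) (n : ℕ) (z : ℕ → ENNReal) :
    (∑ k ∈ Finset.range n, z k) ^ 2 ≤ ENNReal.ofReal (1 / (1 - (β⁻¹) ^ 2)) *
      ∑ k ∈ Finset.range n, ENNReal.ofReal (β ^ k) ^ 2 * z k ^ 2 := by
  have hβ0 : 0 < β := by linarith
  have h := ENNReal.inner_le_Lp_mul_Lq (Finset.range n) (fun k => ENNReal.ofReal ((β⁻¹) ^ k))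
    (fun k => ENNReal.ofReal (β ^ k) * z k) Real.HolderConjugate.two_two
  have e : ∀ k, ENNReal.ofReal ((β⁻¹) ^ k) * (ENNReal.ofReal (β ^ k) * z k) = z k := by
    intro k
    rw [← mul_assoc, ← ENNReal.ofReal_mul (by positivity), ← mul_pow, inv_mul_cancel₀ hβ0.ne']
    simp
  simp only [e, ENNReal.rpow_two, mul_pow] at h
  have hq0 : 0 ≤ (β⁻¹) ^ 2 := by positivity
  have hq1 : (β⁻¹) ^ 2 < 1 := by
    have : β⁻¹ < 1 := inv_lt_one_of_one_lt₀ hβ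
    have : 0 < β⁻¹ := by positivity
    nlinarith
  have hgeo : ∑ k ∈ Finset.range n, ENNReal.ofReal ((β⁻¹) ^ k) ^ 2 ≤ ENNReal.ofReal (1 / (1 - (β⁻¹) ^ 2)) := by
    have : ∀ k, ENNReal.ofReal ((β⁻¹) ^ k) ^ 2 = ENNReal.ofReal (((β⁻¹) ^ 2) ^ k) := by
      intro k
      rw [← ENNReal.ofReal_pow (by positivity)]; congr 1; rw [← pow_mul, ← pow_mul, mul_comm]
    simp_rw [this]
    rw [← ENNReal.ofReal_sum_of_nonneg (fun _ _ => by positivity)]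
    apply ENNReal.ofReal_le_ofReal
    rw [one_div, ← tsum_geometric_of_lt_one hq0 hq1]
    exact (summable_geometric_of_lt_one hq0 hq1).sum_le_tsum _ (fun _ _ => by positivity)
  calc _ ≤ ((∑ k ∈ Finset.range n, ENNReal.ofReal ((β⁻¹) ^ k) ^ 2) ^ (1 / 2 : ℝ) *
        (∑ k ∈ Finset.range n, ENNReal.ofReal (β ^ k) ^ 2 * z k ^ 2) ^ (1 / 2 : ℝ)) ^ 2 := by gcongr
    _ = (∑ k ∈ Finset.range n, ENNReal.ofReal ((β⁻¹) ^ k) ^ 2) *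
        (∑ k ∈ Finset.range n, ENNReal.ofReal (β ^ k) ^ 2 * z k ^ 2) := by
      rw [mul_pow, ← ENNReal.rpow_natCast, ← ENNReal.rpow_natCast, ← ENNReal.rpow_mul, ← ENNReal.rpow_mul]
      norm_num
    _ ≤ _ := by gcongr

noncomputable def dyk (ξ : ℝ) : ℕ := Nat.size ⌊|ξ|⌋₊

lemma dyk_meas : Measurable dyk :=
  (Measurable.of_discrete (f := Nat.size)).comp (Nat.measurable_floor.comp (by fun_prop : Measurable fun ξ : ℝ => |ξ|))

lemma dyk_le (ξ : ℝ) : |ξ| ≤ 2 ^ dyk ξ := by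
  have h1 := Nat.lt_floor_add_one |ξ|
  have h2 : ⌊|ξ|⌋₊ + 1 ≤ 2 ^ dyk ξ := Nat.lt_size_self _
  have h3 : ((⌊|ξ|⌋₊ : ℝ) + 1) ≤ 2 ^ dyk ξ := by exact_mod_cast h2
  linarith

lemma dyk_ge (ξ : ℝ) : (4 : ℝ) ^ dyk ξ ≤ 4 * (1 + ξ ^ 2) := by
  rcases hk : dyk ξ with _ | j
  · nlinarith [sq_nonneg ξ]
  · have h1 : j < Nat.size ⌊|ξ|⌋₊ := by
      have : dyk ξ = Nat.size ⌊|ξ|⌋₊ := rfl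
      omega
    have h2 : (2 : ℝ) ^ j ≤ (⌊|ξ|⌋₊ : ℝ) := by exact_mod_cast Nat.lt_size.mp h1
    have h3 : (2 : ℝ) ^ j ≤ |ξ| := h2.trans (Nat.floor_le (abs_nonneg ξ))
    have h4 : (4 : ℝ) ^ j = ((2 : ℝ) ^ j) ^ 2 := by rw [← pow_mul, mul_comm, pow_mul]; norm_num
    have h5 : ((2 : ℝ) ^ j) ^ 2 ≤ |ξ| ^ 2 := by gcongr
    rw [sq_abs] at h5
    rw [pow_succ, h4]; linarith

lemma airy_core (s : ℝ) (hs : 1 / 4 < s) : ∃ K : ℝ, 0 < K ∧ ∀ N : ℝ, 1 ≤ N → ∀ F G : ℝ → ℂ,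
    Measurable F → Integrable F → Measurable G → Integrable G →
    (∀ ξ, F ξ ≠ 0 → N ≤ |ξ|) → (∀ ξ, G ξ ≠ 0 → |ξ| ≤ N / 100) →
    ∫⁻ x : ℝ, (∫⁻ t : ℝ, ‖airyV F x t * airyV G x t‖ₑ ^ 2) ^ 2 ≤
      ENNReal.ofReal (K / N ^ 4) * ((∫⁻ ξ, ‖F ξ‖ₑ ^ 2) *
        ∫⁻ ξ, ENNReal.ofReal ((1 + ξ ^ 2) ^ s) * ‖G ξ‖ₑ ^ 2) ^ 2 := by
  set β : ℝ := (2 : ℝ) ^ ((4 * s - 1) / 6) with hβdef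
  have hβ : 1 < β := Real.one_lt_rpow (by norm_num) (by linarith)
  have hβ0 : 0 < β := by linarith
  have hβ6 : β ^ 6 * 2 = ((4 : ℝ) ^ s) ^ 2 := by
    have e1 : β ^ 6 = (2 : ℝ) ^ (4 * s - 1) := by
      rw [hβdef, ← Real.rpow_natCast, ← Real.rpow_mul (by norm_num)]
      congr 1; push_cast; ring
    have e2 : (4 : ℝ) ^ s = 2 ^ (2 * s) := by
      rw [Real.rpow_mul (by norm_num)]; norm_num
    rw [e1, e2, sq, ← Real.rpow_add (by norm_num), ← Real.rpow_add_one (by norm_num)]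
    congr 1; ring
  set c : ℝ := 1 / (1 - (β⁻¹) ^ 2) with hc
  have hc0 : 0 < c := by
    have : β⁻¹ < 1 := inv_lt_one_of_one_lt₀ hβ
    have : 0 < β⁻¹ := by positivity
    have : 0 < 1 - (β⁻¹) ^ 2 := by nlinarith
    positivity
  refine ⟨c ^ 3 * (2 * Real.pi * (2 * Real.pi) ^ 2 * 2 * ((4 : ℝ) ^ s) ^ 2), by positivity, ?_⟩
  intro N hN F G hFm hF hGm hG hFs hGs
  have hN0 : 0 < N := by linarith
  set n : ℕ := Nat.size ⌊N / 100⌋₊ + 1 with hn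
  set Gk : ℕ → ℝ → ℂ := fun k => {ξ | dyk ξ = k}.indicator G with hGk
  have hset : ∀ k, MeasurableSet {ξ | dyk ξ = k} := fun k => dyk_meas (measurableSet_singleton k)
  have hGkm : ∀ k, Measurable (Gk k) := fun k => hGm.indicator (hset k)
  have hGki : ∀ k, Integrable (Gk k) := fun k => hG.indicator (hset k)
  have hGk0 : ∀ k ξ, Gk k ξ ≠ 0 → dyk ξ = k ∧ G ξ ≠ 0 := by
    intro k ξ h
    simp only [hGk, ne_eq, Set.indicator_apply_eq_zero, not_forall] at h
    obtain ⟨h1, h2⟩ := h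
    exact ⟨h1, h2⟩
  have hsum : ∀ ξ, G ξ = ∑ k ∈ Finset.range n, Gk k ξ := by
    intro ξ
    by_cases h : G ξ = 0
    · rw [h]; symm
      refine Finset.sum_eq_zero fun k _ => ?_
      by_contra h'
      exact (hGk0 k ξ h').2 h
    · have hlt : dyk ξ < n := by
        rw [hn, Nat.lt_succ_iff]
        exact Nat.size_le_size (Nat.floor_le_floor (hGs ξ h))
      rw [Finset.sum_eq_single (dyk ξ)]
      · simp [hGk]
      · intro k _ hk
        by_contra h'
        exact hk (hGk0 k ξ h').1.symm
      · intro h'; exact absurd (Finset.mem_range.mpr hlt) h'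
  have hV : ∀ x t, airyV G x t = ∑ k ∈ Finset.range n, airyV (Gk k) x t := by
    intro x t
    unfold airyV
    rw [← integral_finsetSum _ (fun k _ => aux_int_exp x t _ (hGki k))]
    congr 1; ext ξ
    rw [hsum ξ, Finset.mul_sum]
  set f := ∫⁻ ξ, ‖F ξ‖ₑ ^ 2 with hf
  set h : ENNReal := ∫⁻ ξ, ENNReal.ofReal ((1 + ξ ^ 2) ^ s) * ‖G ξ‖ₑ ^ 2 with hh
  set hk : ℕ → ENNReal := fun k => ∫⁻ ξ, ENNReal.ofReal ((1 + ξ ^ 2) ^ s) * ‖Gk k ξ‖ₑ ^ 2 with hhk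
  set A : ℕ → ℝ → ENNReal := fun k x => ∫⁻ t : ℝ, ‖airyV F x t * airyV (Gk k) x t‖ₑ ^ 2 with hA
  set w : ℕ → ENNReal := fun k => ENNReal.ofReal (β ^ k) with hw
  have hm2 : ∀ k, Measurable (fun p : ℝ × ℝ => ‖airyV F p.1 p.2 * airyV (Gk k) p.1 p.2‖ₑ ^ 2) := by
    intro k
    have h1 := airyV_meas F hFm
    have h2 := airyV_meas (Gk k) (hGkm k)
    fun_prop
  have hAm : ∀ k, Measurable (A k) := fun k => (hm2 k).lintegral_prod_right'
  have hA1 : ∀ x, ∫⁻ t : ℝ, ‖airyV F x t * airyV G x t‖ₑ ^ 2 ≤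
      ENNReal.ofReal c * ∑ k ∈ Finset.range n, w k ^ 2 * A k x := by
    intro x
    calc _ ≤ ∫⁻ t : ℝ, ENNReal.ofReal c * ∑ k ∈ Finset.range n, w k ^ 2 * ‖airyV F x t * airyV (Gk k) x t‖ₑ ^ 2 := by
          refine lintegral_mono fun t => ?_
          rw [hV, Finset.mul_sum]
          refine le_trans ?_ (aux_cs_sum β hβ n (fun k => ‖airyV F x t * airyV (Gk k) x t‖ₑ))
          gcongr
          exact enorm_sum_le _ _
      _ = _ := by
          have hm3 : ∀ k, Measurable (fun t : ℝ => ‖airyV F x t * airyV (Gk k) x t‖ₑ ^ 2) := fun k =>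
            (hm2 k).comp (f := fun t : ℝ => (x, t)) (by fun_prop)
          rw [lintegral_const_mul' _ _ (by finiteness), lintegral_finsetSum _ (fun k _ => (hm3 k).const_mul _)]
          congr 1
          refine Finset.sum_congr rfl fun k _ => ?_
          rw [lintegral_const_mul _ (hm3 k)]
  have hpiece : ∀ k, ∫⁻ x, A k x ^ 2 ≤ ENNReal.ofReal (2 * Real.pi * (2 * Real.pi / N ^ 2) ^ 2 * (2 * 2 ^ k)) *
        (f * ∫⁻ ξ, ‖Gk k ξ‖ₑ ^ 2) ^ 2 := fun k =>
    airy_piece N hN F (Gk k) hFm hF (hGkm k) (hGki k) hFs (fun ξ hξ => hGs ξ (hGk0 k ξ hξ).2) (2 ^ k)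
      (fun ξ hξ => by rw [← (hGk0 k ξ hξ).1]; exact dyk_le ξ)
  have hwt : ∀ k, ENNReal.ofReal (((4 : ℝ) ^ s) ^ k) * ∫⁻ ξ, ‖Gk k ξ‖ₑ ^ 2 ≤ ENNReal.ofReal ((4 : ℝ) ^ s) * hk k := by
    intro k
    rw [hhk]
    simp only
    rw [← lintegral_const_mul' _ _ (by finiteness), ← lintegral_const_mul' _ _ (by finiteness)]
    refine lintegral_mono fun ξ => ?_
    by_cases h0 : Gk k ξ = 0
    · simp [h0]
    · obtain ⟨h1, -⟩ := hGk0 k ξ h0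
      rw [← mul_assoc, ← ENNReal.ofReal_mul (by positivity)]
      gcongr
      rw [← Real.mul_rpow (by norm_num) (by positivity), ← Real.rpow_natCast, ← Real.rpow_mul (by norm_num),
        mul_comm s, Real.rpow_mul (by norm_num), Real.rpow_natCast, ← h1]
      exact Real.rpow_le_rpow (by positivity) (dyk_ge ξ) (by linarith)
  have hksum : ∑ k ∈ Finset.range n, hk k ≤ h := by
    rw [hhk]
    simp only
    rw [← lintegral_finsetSum]
    · refine lintegral_mono fun ξ => ?_
      simp only
      rw [← Finset.mul_sum]
      gcongr
      have e : ∀ k, ‖Gk k ξ‖ₑ ^ 2 = if dyk ξ = k then ‖G ξ‖ₑ ^ 2 else 0 := by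
        intro k
        by_cases hd : dyk ξ = k <;> simp [hGk, hd]
      simp_rw [e]
      rw [Finset.sum_ite_eq]
      split_ifs <;> simp
    · intro k _
      have := hGkm k
      fun_prop
  have hsq : ∑ k ∈ Finset.range n, hk k ^ 2 ≤ h ^ 2 := by
    calc _ ≤ ∑ k ∈ Finset.range n, hk k * h := by
          refine Finset.sum_le_sum fun k hkm => ?_
          rw [sq]
          gcongr
          exact (Finset.single_le_sum (f := hk) (fun _ _ => zero_le) hkm).trans hksum
      _ = (∑ k ∈ Finset.range n, hk k) * h := by rw [Finset.sum_mul]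
      _ ≤ _ := by rw [sq]; gcongr
  set Q : ENNReal := ENNReal.ofReal (2 * Real.pi * (2 * Real.pi / N ^ 2) ^ 2 * 2) with hQ
  have hterm : ∀ k, w k ^ 6 * ∫⁻ x, A k x ^ 2 ≤ Q * f ^ 2 * ENNReal.ofReal ((4 : ℝ) ^ s) ^ 2 * hk k ^ 2 := by
    intro k
    have e : w k ^ 6 * ENNReal.ofReal (2 * Real.pi * (2 * Real.pi / N ^ 2) ^ 2 * (2 * 2 ^ k)) =
        Q * ENNReal.ofReal (((4 : ℝ) ^ s) ^ k) ^ 2 := by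
      rw [hw, hQ]
      simp only
      rw [← ENNReal.ofReal_pow (by positivity), ← ENNReal.ofReal_pow (by positivity),
        ← ENNReal.ofReal_mul (by positivity), ← ENNReal.ofReal_mul (by positivity)]
      congr 1
      have : (β ^ k) ^ 6 * 2 ^ k = (((4 : ℝ) ^ s) ^ k) ^ 2 := by
        rw [← pow_mul, mul_comm k 6, pow_mul, ← mul_pow, hβ6, ← pow_mul, ← pow_mul, mul_comm]
      rw [← this]; ring
    calc _ ≤ w k ^ 6 * (ENNReal.ofReal (2 * Real.pi * (2 * Real.pi / N ^ 2) ^ 2 * (2 * 2 ^ k)) *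
        (f * ∫⁻ ξ, ‖Gk k ξ‖ₑ ^ 2) ^ 2) := mul_le_mul' le_rfl (hpiece k)
      _ = Q * f ^ 2 * (ENNReal.ofReal (((4 : ℝ) ^ s) ^ k) * ∫⁻ ξ, ‖Gk k ξ‖ₑ ^ 2) ^ 2 := by
        rw [← mul_assoc, e]; ring
      _ ≤ Q * f ^ 2 * (ENNReal.ofReal ((4 : ℝ) ^ s) * hk k) ^ 2 :=
        mul_le_mul' le_rfl (pow_le_pow_left' (hwt k) 2)
      _ = _ := by ring
  calc _ ≤ ∫⁻ x, ENNReal.ofReal c ^ 3 * ∑ k ∈ Finset.range n, w k ^ 6 * A k x ^ 2 := by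
        refine lintegral_mono fun x => ?_
        calc _ ≤ (ENNReal.ofReal c * ∑ k ∈ Finset.range n, w k ^ 2 * A k x) ^ 2 := pow_le_pow_left' (hA1 x) 2
          _ = ENNReal.ofReal c ^ 2 * (∑ k ∈ Finset.range n, w k ^ 2 * A k x) ^ 2 := mul_pow _ _ _
          _ ≤ ENNReal.ofReal c ^ 2 * (ENNReal.ofReal c * ∑ k ∈ Finset.range n, w k ^ 2 * (w k ^ 2 * A k x) ^ 2) :=
            mul_le_mul' le_rfl (aux_cs_sum β hβ n _)
          _ = _ := by
            rw [← mul_assoc, ← pow_succ]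
            congr 1
            refine Finset.sum_congr rfl fun k _ => ?_
            ring
    _ = ENNReal.ofReal c ^ 3 * ∑ k ∈ Finset.range n, w k ^ 6 * ∫⁻ x, A k x ^ 2 := by
        rw [lintegral_const_mul' _ _ (by finiteness), lintegral_finsetSum _ (fun k _ => ((hAm k).pow_const 2).const_mul _)]
        congr 1
        refine Finset.sum_congr rfl fun k _ => ?_
        rw [lintegral_const_mul _ ((hAm k).pow_const 2)]
    _ ≤ ENNReal.ofReal c ^ 3 * ∑ k ∈ Finset.range n, Q * f ^ 2 * ENNReal.ofReal ((4 : ℝ) ^ s) ^ 2 * hk k ^ 2 :=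
        mul_le_mul' le_rfl (Finset.sum_le_sum fun k _ => hterm k)
    _ ≤ ENNReal.ofReal c ^ 3 * (Q * f ^ 2 * ENNReal.ofReal ((4 : ℝ) ^ s) ^ 2 * h ^ 2) := by
        rw [← Finset.mul_sum]
        gcongr
    _ = (ENNReal.ofReal c ^ 3 * Q * ENNReal.ofReal ((4 : ℝ) ^ s) ^ 2) * (f * h) ^ 2 := by ring
    _ = _ := by
        congr 1
        rw [hQ, ← ENNReal.ofReal_pow (by positivity), ← ENNReal.ofReal_pow (by positivity),
          ← ENNReal.ofReal_mul (by positivity), ← ENNReal.ofReal_mul (by positivity)]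
        congr 1
        field_simp

theorem stmt_3 (s : ℝ) (hs : 1 / 4 < s) :
    ∃ C : ℝ, 0 < C ∧ ∀ N : ℝ, 1 ≤ N → ∀ F G : SchwartzMap ℝ ℂ,
      (Function.support (F : ℝ → ℂ) ⊆ {ξ : ℝ | N ≤ |ξ| ∧ |ξ| ≤ 2 * N}) →
      (Function.support (G : ℝ → ℂ) ⊆ {ξ : ℝ | |ξ| ≤ N / 100}) →
      (∫ x : ℝ, (∫ t : ℝ,
          ‖(∫ ξ : ℝ, Complex.exp (Complex.I * (x * ξ + t * ξ ^ 3)) * F ξ) *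
            (∫ ξ : ℝ, Complex.exp (Complex.I * (x * ξ + t * ξ ^ 3)) * G ξ)‖ ^ 2) ^ 2)
          ^ ((1 : ℝ) / 4)
        ≤ (C / N) * (∫ ξ : ℝ, ‖F ξ‖ ^ 2) ^ ((1 : ℝ) / 2) *
            (∫ ξ : ℝ, (1 + ξ ^ 2) ^ s * ‖G ξ‖ ^ 2) ^ ((1 : ℝ) / 2) := by
  obtain ⟨K, hK, hcore⟩ := airy_core s hs
  refine ⟨K ^ ((1 : ℝ) / 4), by positivity, ?_⟩
  intro N hN F G hF hG
  have hN0 : 0 < N := by linarith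
  have h := hcore N hN F G F.continuous.measurable F.integrable G.continuous.measurable G.integrable
    (fun ξ hξ => (hF hξ).1) (fun ξ hξ => hG hξ)
  change (∫ x : ℝ, (∫ t : ℝ, ‖airyV F x t * airyV G x t‖ ^ 2) ^ 2) ^ ((1 : ℝ) / 4) ≤ _
  set X := ∫ x : ℝ, (∫ t : ℝ, ‖airyV F x t * airyV G x t‖ ^ 2) ^ 2 with hX
  set f := ∫ ξ : ℝ, ‖F ξ‖ ^ 2 with hf
  set g := ∫ ξ : ℝ, (1 + ξ ^ 2) ^ s * ‖G ξ‖ ^ 2 with hg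
  have hX0 : 0 ≤ X := integral_nonneg fun x => by positivity
  have hf0 : 0 ≤ f := integral_nonneg fun x => by positivity
  have hg0 : 0 ≤ g := integral_nonneg fun x => by positivity
  have hFc : HasCompactSupport (F : ℝ → ℂ) := by
    refine HasCompactSupport.of_support_subset_isCompact (isCompact_Icc (a := -(2 * N)) (b := 2 * N)) ?_
    exact fun ξ hξ => abs_le.mp (hF hξ).2
  have hGc : HasCompactSupport (G : ℝ → ℂ) := by
    refine HasCompactSupport.of_support_subset_isCompact (isCompact_Icc (a := -(N / 100)) (b := N / 100)) ?_
    exact fun ξ hξ => abs_le.mp (hG hξ)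
  have hfe : ∫⁻ ξ, ‖F ξ‖ₑ ^ 2 = ENNReal.ofReal f := by
    have hi : Integrable (fun ξ => ‖F ξ‖ ^ 2) := by
      refine Continuous.integrable_of_hasCompactSupport (by have := F.continuous; fun_prop) ?_
      exact hFc.comp_left (g := fun z : ℂ => ‖z‖ ^ 2) (by simp)
    rw [hf, ofReal_integral_eq_lintegral_ofReal hi (Filter.Eventually.of_forall fun ξ => by positivity)]
    refine lintegral_congr fun ξ => ?_
    rw [ENNReal.ofReal_pow (norm_nonneg _), ofReal_norm]
  have hge : ∫⁻ ξ, ENNReal.ofReal ((1 + ξ ^ 2) ^ s) * ‖G ξ‖ₑ ^ 2 = ENNReal.ofReal g := by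
    have hi : Integrable (fun ξ : ℝ => (1 + ξ ^ 2) ^ s * ‖G ξ‖ ^ 2) := by
      refine Continuous.integrable_of_hasCompactSupport ?_ ?_
      · refine Continuous.mul ?_ (by have := G.continuous; fun_prop)
        exact Continuous.rpow_const (by fun_prop) (fun ξ => Or.inl (by positivity))
      · exact (hGc.comp_left (g := fun z : ℂ => ‖z‖ ^ 2) (by simp)).mul_left
    rw [hg, ofReal_integral_eq_lintegral_ofReal hi (Filter.Eventually.of_forall fun ξ => by positivity)]
    refine lintegral_congr fun ξ => ?_
    rw [ENNReal.ofReal_mul (by positivity), ENNReal.ofReal_pow (norm_nonneg _), ofReal_norm]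
  have hXe : ENNReal.ofReal X ≤ ∫⁻ x : ℝ, (∫⁻ t : ℝ, ‖airyV F x t * airyV G x t‖ₑ ^ 2) ^ 2 := by
    have e1 : ENNReal.ofReal X = ‖X‖ₑ := by rw [← ofReal_norm, Real.norm_of_nonneg hX0]
    rw [e1, hX]
    refine (enorm_integral_le_lintegral_enorm _).trans (lintegral_mono fun x => ?_)
    rw [enorm_pow]
    gcongr
    refine (enorm_integral_le_lintegral_enorm _).trans (lintegral_mono fun t => ?_)
    rw [enorm_pow, enorm_norm]
  rw [hfe, hge, ← ENNReal.ofReal_mul hf0, ← ENNReal.ofReal_pow (by positivity), ← ENNReal.ofReal_mul (by positivity)] at h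
  have hfin : X ≤ K / N ^ 4 * (f * g) ^ 2 := (ENNReal.ofReal_le_ofReal_iff (by positivity)).mp (hXe.trans h)
  have h4 : ∀ a : ℝ, 0 ≤ a → (a ^ ((1 : ℝ) / 4)) ^ 4 = a := by
    intro a ha
    rw [← Real.rpow_natCast, ← Real.rpow_mul ha]; norm_num
  have h2 : ∀ a : ℝ, 0 ≤ a → (a ^ ((1 : ℝ) / 2)) ^ 4 = a ^ 2 := by
    intro a ha
    rw [← Real.rpow_natCast, ← Real.rpow_mul ha]; norm_num
  refine le_of_pow_le_pow_left₀ (n := 4) (by norm_num) (by positivity) ?_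
  rw [h4 X hX0, mul_pow, mul_pow, div_pow, h4 K hK.le, h2 f hf0, h2 g hg0]
  linarith [hfin, mul_pow f g 2, mul_assoc (K / N ^ 4) (f ^ 2) (g ^ 2), congrArg (fun y => K / N ^ 4 * y) (mul_pow f g 2)]
end

section
/- (Gauge transformation) Let $a,b,c,d,e,\lambda \in \mathbb{R}$ and let $u : \mathbb{R} \times \mathbb{R} \to \mathbb{C}$ be a smooth ($C^\infty$) function. Define $v(x,t) = \exp\big(i\lambda x + i(a\lambda^2 - 2b\lambda^3)t\big)\, u\big(x + (2a\lambda - 3b\lambda^2)t,\; t\big)$. Then $u$ satisfies $\partial_t u + i a\, \partial_x^2 u + b\, \partial_x^3 u + i c\, |u|^2 u + d\, |u|^2 \partial_x u + e\, u^2 \partial_x \bar{u} = 0$ at every point of $\mathbb{R}^2$ if and only if $v$ satisfies $\partial_t v + i(a - 3\lambda b)\, \partial_x^2 v + b\, \partial_x^3 v + i\big(c - \lambda(d-e)\big)\, |v|^2 v + d\, |v|^2 \partial_x v + e\, v^2 \partial_x \bar{v} = 0$ at every point of $\mathbb{R}^2$. -/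
/-- Partial derivative in the first (space) variable. -/
noncomputable def dX (u : ℝ → ℝ → ℂ) : ℝ → ℝ → ℂ := fun x t => deriv (fun y => u y t) x

/-- Partial derivative in the second (time) variable. -/
noncomputable def dT (u : ℝ → ℝ → ℂ) : ℝ → ℝ → ℂ := fun x t => deriv (fun s => u x s) t

/-- The higher-order (Airy–Schrödinger) equation
`∂ₜu + i a ∂ₓ²u + b ∂ₓ³u + i c |u|²u + d |u|² ∂ₓu + e u² ∂ₓū = 0`
(note that `∂ₓū = conj (∂ₓu)`). -/
def HOS (a b c d e : ℝ) (u : ℝ → ℝ → ℂ) : Prop :=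
  ∀ x t : ℝ,
    dT u x t + Complex.I * (a : ℂ) * dX (dX u) x t + (b : ℂ) * dX (dX (dX u)) x t
      + Complex.I * (c : ℂ) * (u x t * (starRingEnd ℂ) (u x t) * u x t)
      + (d : ℂ) * (u x t * (starRingEnd ℂ) (u x t) * dX u x t)
      + (e : ℂ) * ((u x t) ^ 2 * (starRingEnd ℂ) (dX u x t)) = 0


lemma aux_dX_smooth (u : ℝ → ℝ → ℂ)
    (hu : ContDiff ℝ (⊤ : ℕ∞) (fun p : ℝ × ℝ => u p.1 p.2)) :
    ContDiff ℝ (⊤ : ℕ∞) (fun p : ℝ × ℝ => dX u p.1 p.2) := by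
  have h : (fun p : ℝ × ℝ => dX u p.1 p.2) =
      fun p => fderiv ℝ (fun p : ℝ × ℝ => u p.1 p.2) p (1, 0) := by
    funext p
    have h1 : HasFDerivAt (fun p : ℝ × ℝ => u p.1 p.2) _ (p.1, p.2) :=
      (hu.differentiable (by simp) p).hasFDerivAt
    have h2 : HasDerivAt (fun y : ℝ => (y, p.2)) ((1 : ℝ), (0 : ℝ)) p.1 :=
      (hasDerivAt_id p.1).prodMk (hasDerivAt_const p.1 p.2)
    exact (h1.comp_hasDerivAt p.1 h2).deriv
  rw [h]
  exact (hu.fderiv_right (m := (⊤ : ℕ∞)) (by simp)).clm_apply contDiff_const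

lemma aux_dX (u : ℝ → ℝ → ℂ)
    (hu : ContDiff ℝ (⊤ : ℕ∞) (fun p : ℝ × ℝ => u p.1 p.2)) (x t : ℝ) :
    HasDerivAt (fun y => u y t) (dX u x t) x := by
  have h : Differentiable ℝ (fun y => u y t) :=
    (hu.differentiable (by simp)).comp (g := fun p : ℝ × ℝ => u p.1 p.2)
      (f := fun y : ℝ => (y, t)) (by fun_prop)
  exact (h x).hasDerivAt

lemma aux_chain (u : ℝ → ℝ → ℂ)
    (hu : ContDiff ℝ (⊤ : ℕ∞) (fun p : ℝ × ℝ => u p.1 p.2)) (k x t : ℝ) :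
    HasDerivAt (fun s => u (x + k * s) s) (k * dX u (x + k * t) t + dT u (x + k * t) t) t := by
  have h1 : HasFDerivAt (fun p : ℝ × ℝ => u p.1 p.2) _ (x + k * t, t) :=
    (hu.differentiable (by simp) _).hasFDerivAt
  have hx : HasDerivAt (fun y : ℝ => (y, t)) ((1 : ℝ), (0 : ℝ)) (x + k * t) :=
    (hasDerivAt_id _).prodMk (hasDerivAt_const _ _)
  have ht : HasDerivAt (fun s : ℝ => (x + k * t, s)) ((0 : ℝ), (1 : ℝ)) t :=
    (hasDerivAt_const _ _).prodMk (hasDerivAt_id _)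
  have hk : HasDerivAt (fun s : ℝ => (x + k * s, s)) (k, (1 : ℝ)) t :=
    (by simpa using ((hasDerivAt_id t).const_mul k).const_add x :
      HasDerivAt (fun s : ℝ => x + k * s) k t).prodMk (hasDerivAt_id _)
  have ex : dX u (x + k * t) t = _ := (HasFDerivAt.comp_hasDerivAt (f := fun y : ℝ => (y, t)) (x + k * t) h1 hx).deriv
  have et : dT u (x + k * t) t = _ := (HasFDerivAt.comp_hasDerivAt (f := fun s : ℝ => (x + k * t, s)) t h1 ht).deriv
  have := HasFDerivAt.comp_hasDerivAt (f := fun s : ℝ => (x + k * s, s)) t h1 hk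
  have e1 : ((k, 1) : ℝ × ℝ) = k • ((1 : ℝ), (0 : ℝ)) + ((0 : ℝ), (1 : ℝ)) := by simp
  rw [e1, map_add, map_smul, ← ex, ← et, Complex.real_smul] at this
  exact this

lemma aux_gauge (l w k : ℝ) (u : ℝ → ℝ → ℂ)
    (hu : ContDiff ℝ (⊤ : ℕ∞) (fun p : ℝ × ℝ => u p.1 p.2)) :
    dX (fun x t : ℝ => Complex.exp (Complex.I * (l : ℂ) * (x : ℂ) + Complex.I * (w : ℂ) * (t : ℂ)) *
        u (x + k * t) t) =
    fun x t : ℝ => Complex.exp (Complex.I * (l : ℂ) * (x : ℂ) + Complex.I * (w : ℂ) * (t : ℂ)) *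
        (Complex.I * l * u (x + k * t) t + dX u (x + k * t) t) := by
  funext x t
  have h1 : HasDerivAt (fun y : ℝ => Complex.exp (Complex.I * (l : ℂ) * (y : ℂ)
      + Complex.I * (w : ℂ) * (t : ℂ))) _ x :=
    (((Complex.ofRealCLM.hasDerivAt (x := x)).const_mul (Complex.I * (l : ℂ))).add_const
      (Complex.I * (w : ℂ) * (t : ℂ))).cexp
  have h2 := (aux_dX u hu (x + k * t) t).comp_add_const x (k * t)
  have := (h1.mul h2).deriv
  refine this.trans ?_
  simp
  ring

lemma aux_gaugeT (l w k : ℝ) (u : ℝ → ℝ → ℂ)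
    (hu : ContDiff ℝ (⊤ : ℕ∞) (fun p : ℝ × ℝ => u p.1 p.2)) (x t : ℝ) :
    dT (fun x t : ℝ => Complex.exp (Complex.I * (l : ℂ) * (x : ℂ) + Complex.I * (w : ℂ) * (t : ℂ)) *
        u (x + k * t) t) x t =
    Complex.exp (Complex.I * (l : ℂ) * (x : ℂ) + Complex.I * (w : ℂ) * (t : ℂ)) *
        (Complex.I * w * u (x + k * t) t + k * dX u (x + k * t) t + dT u (x + k * t) t) := by
  have h1 : HasDerivAt (fun y : ℝ => Complex.exp (Complex.I * (l : ℂ) * (x : ℂ)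
      + Complex.I * (w : ℂ) * (y : ℂ))) _ t :=
    (((Complex.ofRealCLM.hasDerivAt (x := t)).const_mul (Complex.I * (w : ℂ))).const_add
      (Complex.I * (l : ℂ) * (x : ℂ))).cexp
  have := (h1.mul (aux_chain u hu k x t)).deriv
  refine this.trans ?_
  simp
  ring

lemma aux_dX_lin (m : ℂ) (u : ℝ → ℝ → ℂ) (w : ℝ → ℝ → ℂ)
    (hu : ContDiff ℝ (⊤ : ℕ∞) (fun p : ℝ × ℝ => u p.1 p.2))
    (hw : ContDiff ℝ (⊤ : ℕ∞) (fun p : ℝ × ℝ => w p.1 p.2)) :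
    dX (fun x t => m * u x t + w x t) = fun x t => m * dX u x t + dX w x t := by
  funext x t
  exact (((aux_dX u hu x t).const_mul m).add (aux_dX w hw x t)).deriv

theorem stmt_12 (a b c d e lam : ℝ) (u : ℝ → ℝ → ℂ)
    (hu : ContDiff ℝ (⊤ : ℕ∞) (fun p : ℝ × ℝ => u p.1 p.2))
    (v : ℝ → ℝ → ℂ)
    (hv : ∀ x t : ℝ, v x t =
      Complex.exp (Complex.I * (lam : ℂ) * (x : ℂ)
          + Complex.I * ((a * lam ^ 2 - 2 * b * lam ^ 3 : ℝ) : ℂ) * (t : ℂ)) *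
        u (x + (2 * a * lam - 3 * b * lam ^ 2) * t) t) :
    HOS a b c d e u ↔ HOS (a - 3 * lam * b) b (c - lam * (d - e)) d e v := by
  have hv' : v = fun x t => _ := funext fun x => funext fun t => hv x t
  have s1 := aux_dX_smooth u hu
  have s2 := aux_dX_smooth (dX u) s1
  have s3 : ContDiff ℝ (⊤ : ℕ∞) (fun p : ℝ × ℝ =>
      (fun x t => Complex.I * lam * u x t + dX u x t) p.1 p.2) :=
    (contDiff_const.mul hu).add s1
  have s4 : ContDiff ℝ (⊤ : ℕ∞) (fun p : ℝ × ℝ =>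
      (fun x t => Complex.I * lam * (Complex.I * lam * u x t + dX u x t)
        + (Complex.I * lam * dX u x t + dX (dX u) x t)) p.1 p.2) :=
    (contDiff_const.mul s3).add ((contDiff_const.mul s1).add s2)
  have s5 : ContDiff ℝ (⊤ : ℕ∞) (fun p : ℝ × ℝ =>
      (fun x t => Complex.I * lam * dX u x t + dX (dX u) x t) p.1 p.2) :=
    (contDiff_const.mul s1).add s2
  have L1 := aux_dX_lin (Complex.I * lam) u (dX u) hu s1
  have L2 := aux_dX_lin (Complex.I * lam) (dX u) (dX (dX u)) s1 s2
  have L3 := aux_dX_lin (Complex.I * lam) (fun x t => Complex.I * lam * u x t + dX u x t)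
    (fun x t => Complex.I * lam * dX u x t + dX (dX u) x t) s3 s5
  set k : ℝ := 2 * a * lam - 3 * b * lam ^ 2 with hk
  set w : ℝ := a * lam ^ 2 - 2 * b * lam ^ 3 with hw
  have X1 := aux_gauge lam w k u hu
  have X2 := aux_gauge lam w k (fun x t => Complex.I * lam * u x t + dX u x t) s3
  have X3 := aux_gauge lam w k (fun x t => Complex.I * lam * (Complex.I * lam * u x t + dX u x t)
        + (Complex.I * lam * dX u x t + dX (dX u) x t)) s4
  have T1 := aux_gaugeT lam w k u hu
  rw [← hv'] at X1 T1
  simp only [L1] at X2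
  simp only [L3, L1, L2] at X3
  have key : ∀ x t : ℝ,
    dT v x t + Complex.I * ((a - 3 * lam * b : ℝ) : ℂ) * dX (dX v) x t
      + (b : ℂ) * dX (dX (dX v)) x t
      + Complex.I * ((c - lam * (d - e) : ℝ) : ℂ) * (v x t * (starRingEnd ℂ) (v x t) * v x t)
      + (d : ℂ) * (v x t * (starRingEnd ℂ) (v x t) * dX v x t)
      + (e : ℂ) * ((v x t) ^ 2 * (starRingEnd ℂ) (dX v x t)) =
    Complex.exp (Complex.I * (lam : ℂ) * (x : ℂ) + Complex.I * (w : ℂ) * (t : ℂ)) *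
    (dT u (x + k * t) t + Complex.I * (a : ℂ) * dX (dX u) (x + k * t) t
      + (b : ℂ) * dX (dX (dX u)) (x + k * t) t
      + Complex.I * (c : ℂ) * (u (x + k * t) t * (starRingEnd ℂ) (u (x + k * t) t) * u (x + k * t) t)
      + (d : ℂ) * (u (x + k * t) t * (starRingEnd ℂ) (u (x + k * t) t) * dX u (x + k * t) t)
      + (e : ℂ) * ((u (x + k * t) t) ^ 2 * (starRingEnd ℂ) (dX u (x + k * t) t))) := by
    intro x t
    rw [T1, X1, X2, X3, hv]
    have hE : Complex.exp (Complex.I * (lam : ℂ) * (x : ℂ) + Complex.I * (w : ℂ) * (t : ℂ)) *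
        (starRingEnd ℂ) (Complex.exp (Complex.I * (lam : ℂ) * (x : ℂ)
          + Complex.I * (w : ℂ) * (t : ℂ))) = 1 := by
      rw [← Complex.exp_conj, ← Complex.exp_add]
      simp only [map_mul, map_add, Complex.conj_I, Complex.conj_ofReal]
      rw [← Complex.exp_zero]
      congr 1
      ring
    simp only [map_mul, map_add, Complex.conj_I, Complex.conj_ofReal]
    generalize Complex.exp (Complex.I * (lam : ℂ) * (x : ℂ) + Complex.I * (w : ℂ) * (t : ℂ)) = E at *
    generalize (starRingEnd ℂ) E = F at *
    have hkc : (k : ℂ) = 2 * a * lam - 3 * b * lam ^ 2 := by rw [hk]; push_cast; ring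
    have hwc : (w : ℂ) = a * lam ^ 2 - 2 * b * lam ^ 3 := by rw [hw]; push_cast; ring
    generalize u (x + k * t) t = U
    generalize dX u (x + k * t) t = U1
    generalize dX (dX u) (x + k * t) t = U2
    generalize dX (dX (dX u)) (x + k * t) t = U3
    generalize dT u (x + k * t) t = UT
    rw [hkc, hwc]
    push_cast
    generalize (starRingEnd ℂ) U = V
    generalize (starRingEnd ℂ) U1 = V1
    have hI := Complex.I_sq
    generalize Complex.I = i at *
    generalize (a : ℂ) = a at *
    generalize (b : ℂ) = b at *
    generalize (c : ℂ) = c at *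
    generalize (d : ℂ) = d at *
    generalize (e : ℂ) = e at *
    generalize (lam : ℂ) = l at *
    clear X1 X2 X3 T1 L1 L2 L3 s1 s2 s3 s4 s5
    grind
  constructor
  · intro h x t
    rw [key, h (x + k * t) t, mul_zero]
  · intro h x t
    have h1 := h (x - k * t) t
    rw [key, sub_add_cancel] at h1
    exact (mul_eq_zero.mp h1).resolve_left (Complex.exp_ne_zero _)
end

section
/- Let $a,b,d,e \in \mathbb{R}$ with $b \ne 0$, set $c = (d-e)a/(3b)$, and let $u : \mathbb{R} \times \mathbb{R} \to \mathbb{C}$ be a smooth ($C^\infty$) solution of $\partial_t u + i a\, \partial_x^2 u + b\, \partial_x^3 u + i c\, |u|^2 u + d\, |u|^2 \partial_x u + e\, u^2 \partial_x \bar{u} = 0$ on $\mathbb{R}^2$. Then the function $v(x,t) = \exp\Big( i \frac{a}{3b} x + i \frac{a^3}{27 b^2} t \Big)\, u\Big( x + \frac{a^2}{3b} t,\; t \Big)$ satisfies the complex modified Korteweg–de Vries type equation $\partial_t v + b\, \partial_x^3 v + d\, |v|^2 \partial_x v + e\, v^2 \partial_x \bar{v} = 0$ on $\mathbb{R}^2$.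 -/
/-- The complex modified Korteweg–de Vries type equation
`∂ₜv + b ∂ₓ³v + d |v|² ∂ₓv + e v² ∂ₓv̄ = 0`. -/
def CmKdV (b d e : ℝ) (v : ℝ → ℝ → ℂ) : Prop :=
  ∀ x t : ℝ,
    dT v x t + (b : ℂ) * dX (dX (dX v)) x t
      + (d : ℂ) * (v x t * (starRingEnd ℂ) (v x t) * dX v x t)
      + (e : ℂ) * ((v x t) ^ 2 * (starRingEnd ℂ) (dX v x t)) = 0

abbrev SmoothTwo (w : ℝ → ℝ → ℂ) : Prop :=
  ContDiff ℝ (⊤ : ℕ∞) (fun p : ℝ × ℝ => w p.1 p.2)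

lemma SmoothTwo.hasFD {w : ℝ → ℝ → ℂ} (h : SmoothTwo w) (p : ℝ × ℝ) :
    HasFDerivAt (fun p : ℝ × ℝ => w p.1 p.2)
      (fderiv ℝ (fun p : ℝ × ℝ => w p.1 p.2) p) p :=
  (h.differentiable (by simp)).differentiableAt.hasFDerivAt

lemma SmoothTwo.hasX {w : ℝ → ℝ → ℂ} (h : SmoothTwo w) (x t : ℝ) :
    HasDerivAt (fun y => w y t)
      (fderiv ℝ (fun p : ℝ × ℝ => w p.1 p.2) (x, t) (1, 0)) x :=
  HasFDerivAt.comp_hasDerivAt (f := fun y : ℝ => ((y, t) : ℝ × ℝ)) x (h.hasFD (x, t))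
    ((hasDerivAt_id x).prodMk (hasDerivAt_const x t))

lemma SmoothTwo.hasT {w : ℝ → ℝ → ℂ} (h : SmoothTwo w) (x t : ℝ) :
    HasDerivAt (fun s => w x s)
      (fderiv ℝ (fun p : ℝ × ℝ => w p.1 p.2) (x, t) (0, 1)) t :=
  HasFDerivAt.comp_hasDerivAt (f := fun y : ℝ => ((x, y) : ℝ × ℝ)) t (h.hasFD (x, t))
    ((hasDerivAt_const t x).prodMk (hasDerivAt_id t))

lemma SmoothTwo.dX_eq {w : ℝ → ℝ → ℂ} (h : SmoothTwo w) (x t : ℝ) :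
    dX w x t = fderiv ℝ (fun p : ℝ × ℝ => w p.1 p.2) (x, t) (1, 0) :=
  (h.hasX x t).deriv

lemma SmoothTwo.dT_eq {w : ℝ → ℝ → ℂ} (h : SmoothTwo w) (x t : ℝ) :
    dT w x t = fderiv ℝ (fun p : ℝ × ℝ => w p.1 p.2) (x, t) (0, 1) :=
  (h.hasT x t).deriv

lemma SmoothTwo.hasX' {w : ℝ → ℝ → ℂ} (h : SmoothTwo w) (x t : ℝ) :
    HasDerivAt (fun y => w y t) (dX w x t) x := h.dX_eq x t ▸ h.hasX x t

lemma SmoothTwo.dX {w : ℝ → ℝ → ℂ} (h : SmoothTwo w) : SmoothTwo (dX w) := by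
  have : (fun p : ℝ × ℝ => _root_.dX w p.1 p.2) =
      fun p => fderiv ℝ (fun p : ℝ × ℝ => w p.1 p.2) p (1, 0) := by
    funext p; exact h.dX_eq p.1 p.2
  unfold SmoothTwo
  rw [this]
  exact (h.fderiv_right (m := ((⊤ : ℕ∞) : WithTop ℕ∞)) (by simp)).clm_apply contDiff_const

noncomputable def gaugeG (L M : ℂ) (s : ℝ) (w : ℝ → ℝ → ℂ) : ℝ → ℝ → ℂ :=
  fun x t => Complex.exp (L * (x : ℂ) + M * (t : ℂ)) * w (x + s * t) t

lemma dX_gaugeG (L M : ℂ) (s : ℝ) {w : ℝ → ℝ → ℂ} (h : SmoothTwo w) :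
    dX (gaugeG L M s w) = gaugeG L M s (fun x t => L * w x t + dX w x t) := by
  funext x t
  have h1 : HasDerivAt (fun y : ℝ => L * (y : ℂ) + M * (t : ℂ)) (L * 1) x :=
    ((Complex.ofRealCLM.hasDerivAt (x := x)).const_mul L).add_const _
  have h2 : HasDerivAt (fun y : ℝ => w (y + s * t) t) (dX w (x + s * t) t) x :=
    (h.hasX' (x + s * t) t).comp_add_const x (s * t)
  refine (h1.cexp.mul h2).deriv.trans ?_
  simp only [gaugeG]
  ring

lemma dT_gaugeG (L M : ℂ) (s : ℝ) {w : ℝ → ℝ → ℂ} (h : SmoothTwo w) :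
    dT (gaugeG L M s w) =
      gaugeG L M s (fun x t => M * w x t + s * dX w x t + dT w x t) := by
  funext x t
  have h1 : HasDerivAt (fun y : ℝ => L * (x : ℂ) + M * (y : ℂ)) (M * 1) t :=
    ((Complex.ofRealCLM.hasDerivAt (x := t)).const_mul M).const_add _
  have h0 : HasDerivAt (fun y : ℝ => ((x + s * y, y) : ℝ × ℝ)) (s * 1, 1) t :=
    (((hasDerivAt_id t).const_mul s).const_add x).prodMk (hasDerivAt_id t)
  have h2 : HasDerivAt (fun y : ℝ => w (x + s * y) y) _ t :=
    HasFDerivAt.comp_hasDerivAt (f := fun y : ℝ => ((x + s * y, y) : ℝ × ℝ)) t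
      (h.hasFD (x + s * t, t)) h0
  have h3 : ((s * 1, 1) : ℝ × ℝ) = s • ((1, 0) : ℝ × ℝ) + (0, 1) := by simp
  rw [h3, map_add, map_smul, ← h.dX_eq, ← h.dT_eq, Complex.real_smul] at h2
  refine (h1.cexp.mul h2).deriv.trans ?_
  simp only [gaugeG]
  ring

lemma dX_lin (L : ℂ) {w z : ℝ → ℝ → ℂ} (h : SmoothTwo w) (h' : SmoothTwo z) :
    dX (fun x t => L * w x t + z x t) = fun x t => L * dX w x t + dX z x t := by
  funext x t
  exact (((h.hasX' x t).const_mul L).add (h'.hasX' x t)).deriv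

lemma SmoothTwo.lin (L : ℂ) {w z : ℝ → ℝ → ℂ} (h : SmoothTwo w) (h' : SmoothTwo z) :
    SmoothTwo (fun x t => L * w x t + z x t) :=
  (contDiff_const.mul h).add h'

theorem stmt_13 (a b d e : ℝ) (hb : b ≠ 0) (u : ℝ → ℝ → ℂ)
    (hu : ContDiff ℝ (⊤ : ℕ∞) (fun p : ℝ × ℝ => u p.1 p.2))
    (hsol : HOS a b ((d - e) * a / (3 * b)) d e u)
    (v : ℝ → ℝ → ℂ)
    (hv : ∀ x t : ℝ, v x t =
      Complex.exp (Complex.I * ((a / (3 * b) : ℝ) : ℂ) * (x : ℂ)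
          + Complex.I * ((a ^ 3 / (27 * b ^ 2) : ℝ) : ℂ) * (t : ℂ)) *
        u (x + a ^ 2 / (3 * b) * t) t) :
    CmKdV b d e v := by
  have hu : SmoothTwo u := hu
  obtain rfl : v = gaugeG (Complex.I * ((a / (3 * b) : ℝ) : ℂ))
      (Complex.I * ((a ^ 3 / (27 * b ^ 2) : ℝ) : ℂ)) (a ^ 2 / (3 * b)) u := by
    funext x t; exact hv x t
  intro x t
  have key := hsol (x + a ^ 2 / (3 * b) * t) t
  have hu1 := SmoothTwo.dX hu
  have hu2 := SmoothTwo.dX hu1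
  have hl := SmoothTwo.lin (Complex.I * ((a / (3 * b) : ℝ) : ℂ)) hu hu1
  have hl2 := SmoothTwo.dX hl
  rw [dT_gaugeG _ _ _ hu, dX_gaugeG _ _ _ hu, dX_gaugeG _ _ _ hl,
    dX_gaugeG _ _ _ (SmoothTwo.lin _ hl hl2), dX_lin _ hl hl2, dX_lin _ hu hu1,
    dX_lin _ hu1 hu2]
  simp only [gaugeG]
  set y := x + a ^ 2 / (3 * b) * t
  have hE : Complex.exp (Complex.I * ((a / (3 * b) : ℝ) : ℂ) * (x : ℂ)
      + Complex.I * ((a ^ 3 / (27 * b ^ 2) : ℝ) : ℂ) * (t : ℂ)) *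
      (starRingEnd ℂ) (Complex.exp (Complex.I * ((a / (3 * b) : ℝ) : ℂ) * (x : ℂ)
      + Complex.I * ((a ^ 3 / (27 * b ^ 2) : ℝ) : ℂ) * (t : ℂ))) = 1 := by
    rw [← Complex.exp_conj, ← Complex.exp_add]
    simp only [map_add, map_mul, Complex.conj_I, Complex.conj_ofReal]
    convert Complex.exp_zero using 2
    ring
  set E := Complex.exp (Complex.I * ((a / (3 * b) : ℝ) : ℂ) * (x : ℂ)
      + Complex.I * ((a ^ 3 / (27 * b ^ 2) : ℝ) : ℂ) * (t : ℂ))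
  simp only [map_add, map_mul, Complex.conj_I, Complex.conj_ofReal]
  set E' := (starRingEnd ℂ) E
  generalize dX (dX (dX u)) y t = u3 at *
  generalize dX (dX u) y t = u2 at *
  generalize (starRingEnd ℂ) (dX u y t) = w1 at *
  generalize dX u y t = u1 at *
  generalize (starRingEnd ℂ) (u y t) = w0 at *
  generalize u y t = u0 at *
  generalize dT u y t = ut at *
  have hbC : (b : ℂ) ≠ 0 := by exact_mod_cast hb
  obtain ⟨l, hl⟩ : ∃ l : ℂ, l = a / (3 * b) := ⟨_, rfl⟩
  have ha : (a : ℂ) = 3 * b * l := by rw [hl]; field_simp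
  have e1 : ((a / (3 * b) : ℝ) : ℂ) = l := by rw [hl]; push_cast; rfl
  have e2 : ((a ^ 3 / (27 * b ^ 2) : ℝ) : ℂ) = b * l ^ 3 := by
    push_cast; rw [ha]; field_simp; ring
  have e3 : ((a ^ 2 / (3 * b) : ℝ) : ℂ) = 3 * b * l ^ 2 := by
    push_cast; rw [ha]; field_simp
  have e4 : (((d - e) * a / (3 * b) : ℝ) : ℂ) = (d - e) * l := by
    push_cast; rw [ha]; field_simp
  rw [e1, e2, e3]
  rw [e4, ha] at key
  have hI := Complex.I_sq
  generalize Complex.I = I at *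
  linear_combination E * key + E * (d * u0 * w0 * (I * l * u0 + u1)
    + e * u0 ^ 2 * (-I * l * w0 + w1)) * hE
    + E * (3 * b * l ^ 2 * u1 + b * l ^ 3 * I * u0) * hI
end

section
/- (Two-parameter solitary waves) Let $a, b, d \in \mathbb{R}$ with $b \ne 0$ and $bd > 0$, and let $\eta, N \in \mathbb{R}$. Set $A = \sqrt{d/(6b)}$, $f(x) = 1/(A \cosh x)$, $\psi = 2aN + 3bN^2 - \eta^2 b$, and $\phi = aN^2 + bN^3 - 3\eta^2 b N - a\eta^2$. Then the function $u(x,t) = \eta\, f\big(\eta\,(x + \psi t)\big)\, \exp\big(i(Nx + \phi t)\big)$ satisfies, at every point of $\mathbb{R}^2$, the equation $\partial_t u + i a\, \partial_x^2 u + b\, \partial_x^3 u + i \frac{a}{3b} d\, |u|^2 u + d\, |u|^2 \partial_x u = 0$. -/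
lemma hq_aux (g : ℝ → ℝ) (m x : ℝ) (hg : HasDerivAt g m x) :
    HasDerivAt (fun y => (((Real.cosh (g y))⁻¹ : ℝ) : ℂ))
      (-(m : ℂ) * (((Real.cosh (g x))⁻¹ : ℝ) : ℂ) * ((Real.sinh (g x) / Real.cosh (g x) : ℝ) : ℂ)) x := by
  have hc : Real.cosh (g x) ≠ 0 := (Real.cosh_pos _).ne'
  have h := ((hg.cosh).inv hc).ofReal_comp
  refine h.congr_deriv ?_
  rw [← Complex.ofReal_neg, ← Complex.ofReal_mul, ← Complex.ofReal_mul]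
  congr 1
  field_simp

lemma ht_aux (g : ℝ → ℝ) (m x : ℝ) (hg : HasDerivAt g m x) :
    HasDerivAt (fun y => ((Real.sinh (g y) / Real.cosh (g y) : ℝ) : ℂ))
      ((m : ℂ) * (((Real.cosh (g x))⁻¹ : ℝ) : ℂ) ^ 2) x := by
  have hc : Real.cosh (g x) ≠ 0 := (Real.cosh_pos _).ne'
  have h := ((hg.sinh).div hg.cosh hc).ofReal_comp
  refine h.congr_deriv ?_
  rw [← Complex.ofReal_pow, ← Complex.ofReal_mul]
  congr 1
  field_simp
  have := Real.cosh_sq (g x)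
  rw [this]; ring

lemma he_aux (g : ℝ → ℝ) (m x : ℝ) (hg : HasDerivAt g m x) :
    HasDerivAt (fun y => Complex.exp (Complex.I * ((g y : ℝ) : ℂ)))
      (Complex.I * (m : ℂ) * Complex.exp (Complex.I * ((g x : ℝ) : ℂ))) x := by
  refine ((hg.ofReal_comp.const_mul Complex.I).cexp).congr_deriv ?_
  ring

theorem stmt_14 (a b d : ℝ) (hb : b ≠ 0) (hbd : 0 < b * d) (η N : ℝ)
    (A : ℝ) (hA : A = Real.sqrt (d / (6 * b)))
    (f : ℝ → ℝ) (hf : ∀ x : ℝ, f x = 1 / (A * Real.cosh x))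
    (ψ φ : ℝ) (hψ : ψ = 2 * a * N + 3 * b * N ^ 2 - η ^ 2 * b)
    (hφ : φ = a * N ^ 2 + b * N ^ 3 - 3 * η ^ 2 * b * N - a * η ^ 2)
    (u : ℝ → ℝ → ℂ)
    (hu : ∀ x t : ℝ, u x t =
      ((η * f (η * (x + ψ * t)) : ℝ) : ℂ) *
        Complex.exp (Complex.I * ((N * x + φ * t : ℝ) : ℂ))) :
    ∀ x t : ℝ,
      dT u x t + Complex.I * (a : ℂ) * dX (dX u) x t + (b : ℂ) * dX (dX (dX u)) x t
        + Complex.I * ((a / (3 * b) * d : ℝ) : ℂ) *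
            (u x t * (starRingEnd ℂ) (u x t) * u x t)
        + (d : ℂ) * (u x t * (starRingEnd ℂ) (u x t) * dX u x t) = 0 := by
  have hA2 : A ^ 2 * (6 * b) = d := by
    have hpos : 0 ≤ d / (6 * b) := by
      have : d / (6 * b) = (b * d) / (6 * b ^ 2) := by field_simp
      rw [this]; positivity
    rw [hA, Real.sq_sqrt hpos]; field_simp
  have hd : d ≠ 0 := by rintro rfl; simp at hbd
  have hA0 : A ≠ 0 := by rintro rfl; apply hd; rw [← hA2]; ring
  obtain ⟨k, hk⟩ : ∃ k : ℝ, k = η / A := ⟨_, rfl⟩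
  have hk2 : d * k ^ 2 = 6 * b * η ^ 2 := by
    rw [hk, ← hA2]; field_simp
  obtain ⟨q, hq⟩ : ∃ q : ℝ → ℝ → ℂ, q = fun x t => (((Real.cosh (η * (x + ψ * t)))⁻¹ : ℝ) : ℂ) := ⟨_, rfl⟩
  obtain ⟨τ, hτ⟩ : ∃ τ : ℝ → ℝ → ℂ, τ = fun x t => ((Real.sinh (η * (x + ψ * t)) / Real.cosh (η * (x + ψ * t)) : ℝ) : ℂ) := ⟨_, rfl⟩
  obtain ⟨E, hE⟩ : ∃ E : ℝ → ℝ → ℂ, E = fun x t => Complex.exp (Complex.I * ((N * x + φ * t : ℝ) : ℂ)) := ⟨_, rfl⟩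
  have gx : ∀ x t : ℝ, HasDerivAt (fun y => η * (y + ψ * t)) η x := fun x t => by
    simpa using ((hasDerivAt_id x).add_const (ψ * t)).const_mul η
  have gt : ∀ x t : ℝ, HasDerivAt (fun s => η * (x + ψ * s)) (η * ψ) t := fun x t => by
    simpa using (((hasDerivAt_id t).const_mul ψ).const_add x).const_mul η
  have ex : ∀ x t : ℝ, HasDerivAt (fun y => N * y + φ * t) N x := fun x t => by
    simpa using ((hasDerivAt_id x).const_mul N).add_const (φ * t)
  have et : ∀ x t : ℝ, HasDerivAt (fun s => N * x + φ * s) φ t := fun x t => by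
    simpa using ((hasDerivAt_id t).const_mul φ).const_add (N * x)
  have qx : ∀ x t : ℝ, HasDerivAt (fun y => q y t) (-(η : ℂ) * q x t * τ x t) x := fun x t => by
    subst hq hτ; exact hq_aux _ _ _ (gx x t)
  have qt : ∀ x t : ℝ, HasDerivAt (fun s => q x s) (-((η * ψ : ℝ) : ℂ) * q x t * τ x t) t := fun x t => by
    subst hq hτ; exact hq_aux _ _ _ (gt x t)
  have tx : ∀ x t : ℝ, HasDerivAt (fun y => τ y t) ((η : ℂ) * q x t ^ 2) x := fun x t => by
    subst hq hτ; exact ht_aux _ _ _ (gx x t)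
  have Ex : ∀ x t : ℝ, HasDerivAt (fun y => E y t) (Complex.I * (N : ℂ) * E x t) x := fun x t => by
    subst hE; exact he_aux _ _ _ (ex x t)
  have Et : ∀ x t : ℝ, HasDerivAt (fun s => E x s) (Complex.I * (φ : ℂ) * E x t) t := fun x t => by
    subst hE; exact he_aux _ _ _ (et x t)
  have hqt : ∀ x t : ℝ, τ x t ^ 2 = 1 - q x t ^ 2 := fun x t => by
    subst hq hτ
    have hc : Real.cosh (η * (x + ψ * t)) ≠ 0 := (Real.cosh_pos _).ne'
    have h := Real.cosh_sq (η * (x + ψ * t))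
    simp only []
    norm_cast
    field_simp
    rw [h]; ring
  have hqc : ∀ x t : ℝ, (starRingEnd ℂ) (q x t) = q x t := fun x t => by
    subst hq; exact Complex.conj_ofReal _
  have hEc : ∀ x t : ℝ, E x t * (starRingEnd ℂ) (E x t) = 1 := fun x t => by
    subst hE
    simp only []
    rw [← Complex.exp_conj, ← Complex.exp_add, map_mul, Complex.conj_I, Complex.conj_ofReal]
    simp
  have u0 : u = fun x t => (k : ℂ) * q x t * E x t := by
    funext x t
    rw [hu, hf, hk, hq, hE]
    simp only []
    rw [← Complex.ofReal_mul]
    congr 2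
    have hc : Real.cosh (η * (x + ψ * t)) ≠ 0 := (Real.cosh_pos _).ne'
    field_simp
  have u1 : dX u = fun x t => (k : ℂ) * q x t * E x t * (Complex.I * N - η * τ x t) := by
    funext x t
    rw [u0]
    refine ((((qx x t).const_mul (k : ℂ)).mul (Ex x t)).congr_deriv ?_).deriv
    ring
  have u2 : dX (dX u) = fun x t => (k : ℂ) * q x t * E x t *
      ((Complex.I * N - η * τ x t) ^ 2 - η ^ 2 * q x t ^ 2) := by
    funext x t
    rw [u1]
    refine (((((qx x t).const_mul (k : ℂ)).mul (Ex x t)).mul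
      (((tx x t).const_mul (η : ℂ)).const_sub (Complex.I * N))).congr_deriv ?_).deriv
    simp only [Pi.mul_apply]
    ring
  have u3 : dX (dX (dX u)) = fun x t => (k : ℂ) * q x t * E x t *
      ((Complex.I * N - η * τ x t) * ((Complex.I * N - η * τ x t) ^ 2 - η ^ 2 * q x t ^ 2)
        - 2 * η ^ 2 * q x t ^ 2 * (Complex.I * N - η * τ x t) + 2 * η ^ 3 * q x t ^ 2 * τ x t) := by
    funext x t
    rw [u2]
    refine (((((qx x t).const_mul (k : ℂ)).mul (Ex x t)).mul
      (((((tx x t).const_mul (η : ℂ)).const_sub (Complex.I * N)).pow 2).sub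
        (((qx x t).pow 2).const_mul ((η : ℂ) ^ 2)))).congr_deriv ?_).deriv
    simp only [Pi.mul_apply, Pi.sub_apply, Pi.pow_apply]
    push_cast
    ring
  have ut : dT u = fun x t => (k : ℂ) * q x t * E x t * (Complex.I * φ - η * ψ * τ x t) := by
    funext x t
    rw [u0]
    refine ((((qt x t).const_mul (k : ℂ)).mul (Et x t)).congr_deriv ?_).deriv
    push_cast
    ring
  intro x t
  rw [u3, u2, u1, ut, u0]
  simp only [map_mul, hqc, Complex.conj_ofReal]
  have had : ((a / (3 * b) * d : ℝ) : ℂ) * (k : ℂ) ^ 2 = 2 * a * η ^ 2 := by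
    have : a / (3 * b) * d * k ^ 2 = 2 * a * η ^ 2 := by
      rw [mul_assoc, hk2]; field_simp; ring
    exact_mod_cast this
  have hk2' : (d : ℂ) * (k : ℂ) ^ 2 = 6 * b * η ^ 2 := by exact_mod_cast hk2
  have hψ' : (ψ : ℂ) = 2 * a * N + 3 * b * N ^ 2 - η ^ 2 * b := by rw [hψ]; push_cast; ring
  have hφ' : (φ : ℂ) = a * N ^ 2 + b * N ^ 3 - 3 * η ^ 2 * b * N - a * η ^ 2 := by
    rw [hφ]; push_cast; ring
  have h1 := hEc x t
  have h2 := hqt x t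
  have hI := Complex.I_sq
  rw [hψ', hφ']
  generalize ((a / (3 * b) * d : ℝ) : ℂ) = D at *
  generalize (starRingEnd ℂ) (E x t) = F at *
  generalize E x t = e at *
  generalize q x t = Q at *
  generalize τ x t = T at *
  generalize Complex.I = I at *
  have h3 : ∀ w : ℂ, (k : ℂ) * Q * e * (k * Q * F) * w = k ^ 2 * Q ^ 2 * w := fun w => by
    linear_combination (k : ℂ) ^ 2 * Q ^ 2 * w * h1
  rw [mul_assoc, h3, h3] <;> skip
  have hT3 : T ^ 3 = T * (1 - Q ^ 2) := by rw [← h2]; ring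
  have hI3 : I ^ 3 = -I := by linear_combination I * hI
  linear_combination (exp := 1) (k : ℂ) * Q * e * (I * Q ^ 2 * had + Q ^ 2 * (I * N - η * T) * hk2')
    + (k : ℂ) * Q * e * (I * a * η ^ 2 + 3 * b * I * N * η ^ 2) * h2
    + (k : ℂ) * Q * e * (-b * η ^ 3) * hT3
    + (k : ℂ) * Q * e * (b * N ^ 3) * hI3
    + (k : ℂ) * Q * e * (I * a * N ^ 2 - 2 * a * N * η * T - 3 * b * N ^ 2 * η * T) * hI
end

section
/- (One-parameter solitary waves) Let $a, b, c, d, e \in \mathbb{R}$ with $b \ne 0$, $e \ne 0$ and $b(d+e) > 0$, and let $\eta \in \mathbb{R}$. Set $A = \sqrt{(e+d)/(6b)}$, $g(x) = 1/(A \cosh x)$, $w = (c - 2aA^2)/(2e)$, $\psi = 2aw + 3bw^2 - \eta^2 b$, and $\phi = aw^2 + bw^3 - 3\eta^2 b w - a\eta^2$. Then the function $u(x,t) = \eta\, g\big(\eta\,(x + \psi t)\big)\, \exp\big(i(wx + \phi t)\big)$ satisfies, at every point of $\mathbb{R}^2$, the equation $\partial_t u + i a\, \partial_x^2 u + b\,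 \partial_x^3 u + i c\, |u|^2 u + d\, |u|^2 \partial_x u + e\, u^2 \partial_x \bar{u} = 0$. -/
lemma aux_dx (F : ℝ → ℂ) (F' : ℂ) (w φ ψ x t : ℝ) (h : HasDerivAt F F' (x + ψ * t)) :
    HasDerivAt (fun y : ℝ => F (y + ψ * t) * Complex.exp (Complex.I * ((w * y + φ * t : ℝ) : ℂ)))
      ((F' + Complex.I * w * F (x + ψ * t)) *
        Complex.exp (Complex.I * ((w * x + φ * t : ℝ) : ℂ))) x := by
  have h1 : HasDerivAt (fun y : ℝ => F (y + ψ * t)) F' x := h.comp_add_const x (ψ * t)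
  have h2 : HasDerivAt (fun y : ℝ => w * y + φ * t) w x := by
    simpa using ((hasDerivAt_id x).const_mul w).add_const (φ * t)
  have h3 := (h2.ofReal_comp.const_mul Complex.I).cexp
  exact (h1.mul h3).congr_deriv (by ring)

lemma aux_dt (F : ℝ → ℂ) (F' : ℂ) (w φ ψ x t : ℝ) (h : HasDerivAt F F' (x + ψ * t)) :
    HasDerivAt (fun s : ℝ => F (x + ψ * s) * Complex.exp (Complex.I * ((w * x + φ * s : ℝ) : ℂ)))
      ((ψ * F' + Complex.I * φ * F (x + ψ * t)) *
        Complex.exp (Complex.I * ((w * x + φ * t : ℝ) : ℂ))) t := by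
  have h0 : HasDerivAt (fun s : ℝ => x + ψ * s) ψ t := by
    simpa using ((hasDerivAt_id t).const_mul ψ).const_add x
  have h1 : HasDerivAt (fun s : ℝ => F (x + ψ * s)) ((ψ : ℂ) * F') t := by
    exact (HasDerivAt.scomp t h h0).congr_deriv (by simp)
  have h2 : HasDerivAt (fun s : ℝ => w * x + φ * s) φ t := by
    simpa using ((hasDerivAt_id t).const_mul φ).const_add (w * x)
  have h3 := (h2.ofReal_comp.const_mul Complex.I).cexp
  exact (h1.mul h3).congr_deriv (by ring)

theorem stmt_15 (a b c d e : ℝ) (hb : b ≠ 0) (he : e ≠ 0) (hbde : 0 < b * (d + e))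
    (η : ℝ)
    (A : ℝ) (hA : A = Real.sqrt ((e + d) / (6 * b)))
    (g : ℝ → ℝ) (hg : ∀ x : ℝ, g x = 1 / (A * Real.cosh x))
    (w ψ φ : ℝ) (hw : w = (c - 2 * a * A ^ 2) / (2 * e))
    (hψ : ψ = 2 * a * w + 3 * b * w ^ 2 - η ^ 2 * b)
    (hφ : φ = a * w ^ 2 + b * w ^ 3 - 3 * η ^ 2 * b * w - a * η ^ 2)
    (u : ℝ → ℝ → ℂ)
    (hu : ∀ x t : ℝ, u x t =
      ((η * g (η * (x + ψ * t)) : ℝ) : ℂ) *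
        Complex.exp (Complex.I * ((w * x + φ * t : ℝ) : ℂ))) :
    HOS a b c d e u := by
  have hpos : 0 < (e + d) / (6 * b) := by
    have : (e + d) / (6 * b) = (b * (d + e)) / (6 * b ^ 2) := by field_simp; ring
    rw [this]; positivity
  have hA0 : A ≠ 0 := by rw [hA]; exact (Real.sqrt_pos.2 hpos).ne'
  have hA2 : d = 6 * b * A ^ 2 - e := by
    rw [hA, Real.sq_sqrt hpos.le]; field_simp; ring
  have hc : c = 2 * e * w + 2 * a * A ^ 2 := by rw [hw]; field_simp; ring
  set q : ℝ → ℝ := fun z => η * g (η * z) with hq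
  set r : ℝ → ℝ := fun z => -η ^ 2 * Real.sinh (η * z) / (A * Real.cosh (η * z) ^ 2) with hr
  have hlin : ∀ z, HasDerivAt (fun z : ℝ => η * z) η z := fun z => by
    simpa using (hasDerivAt_id z).const_mul η
  have hq1 : ∀ z, HasDerivAt q (r z) z := by
    intro z
    have hc0 := (Real.cosh_pos (η * z)).ne'
    have h := (((hlin z).cosh.const_mul A).inv (mul_ne_zero hA0 hc0)).const_mul η
    have hqe : q = fun z => η * (A * Real.cosh (η * z))⁻¹ := by
      funext z; simp only [hq, hg, one_div]
    rw [hqe]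
    refine h.congr_deriv ?_
    simp only [hr]; field_simp
  have hr1 : ∀ z, HasDerivAt r (η ^ 2 * q z - 2 * A ^ 2 * q z ^ 3) z := by
    intro z
    have hc0 := (Real.cosh_pos (η * z)).ne'
    have h := ((hlin z).sinh.const_mul (-η ^ 2)).div (((hlin z).cosh.pow 2).const_mul A)
      (mul_ne_zero hA0 (pow_ne_zero 2 hc0))
    refine h.congr_deriv ?_
    simp only [hq, hg, Pi.pow_apply]
    have hs := Real.cosh_sq (η * z)
    have hs' : Real.sinh (η * z) ^ 2 = Real.cosh (η * z) ^ 2 - 1 := by linarith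
    field_simp
    simp only [Nat.cast_ofNat, Nat.add_one_sub_one, pow_one]
    ring_nf
    simp only [hs']
    ring
  have hp1 : ∀ z, HasDerivAt (fun z => η ^ 2 * q z - 2 * A ^ 2 * q z ^ 3)
      (η ^ 2 * r z - 6 * A ^ 2 * q z ^ 2 * r z) z := by
    intro z
    refine (((hq1 z).const_mul (η ^ 2)).sub (((hq1 z).pow 3).const_mul (2 * A ^ 2))).congr_deriv ?_
    simp; ring
  set E : ℝ → ℝ → ℂ := fun x t => Complex.exp (Complex.I * ((w * x + φ * t : ℝ) : ℂ)) with hE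
  have hcq := fun z => (hq1 z).ofReal_comp
  have hcr := fun z => (hr1 z).ofReal_comp
  have hcp := fun z => (hp1 z).ofReal_comp
  have hu0 : u = fun x t => (fun z => (q z : ℂ)) (x + ψ * t) * E x t := by
    funext x t; exact hu x t
  set F1 : ℝ → ℂ := fun z => (r z : ℂ) + Complex.I * w * q z with hF1
  have hd1 : ∀ z, HasDerivAt F1 (((η ^ 2 * q z - 2 * A ^ 2 * q z ^ 3 : ℝ) : ℂ)
      + Complex.I * w * r z) z := fun z => (hcr z).add ((hcq z).const_mul _)
  set F2 : ℝ → ℂ := fun z => (((η ^ 2 * q z - 2 * A ^ 2 * q z ^ 3 : ℝ) : ℂ)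
      + Complex.I * w * r z) + Complex.I * w * F1 z with hF2
  have hd2 : ∀ z, HasDerivAt F2 (((η ^ 2 * r z - 6 * A ^ 2 * q z ^ 2 * r z : ℝ) : ℂ)
      + Complex.I * w * ((η ^ 2 * q z - 2 * A ^ 2 * q z ^ 3 : ℝ) : ℂ)
      + Complex.I * w * (((η ^ 2 * q z - 2 * A ^ 2 * q z ^ 3 : ℝ) : ℂ)
      + Complex.I * w * r z)) z :=
    fun z => ((hcp z).add ((hcr z).const_mul _)).add ((hd1 z).const_mul _)
  have e1 : dX u = fun x t => F1 (x + ψ * t) * E x t := by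
    rw [hu0]; funext x t
    exact (aux_dx _ _ w φ ψ x t (hcq _)).deriv
  have e2 : dX (dX u) = fun x t => F2 (x + ψ * t) * E x t := by
    rw [e1]; funext x t
    exact (aux_dx _ _ w φ ψ x t (hd1 _)).deriv
  intro x t
  have e3 := (aux_dx _ _ w φ ψ x t (hd2 _)).deriv
  have e3' := e3
  change deriv (fun y => (fun x t => F2 (x + ψ * t) * E x t) y t) x = _ at e3'
  rw [← e2] at e3'
  change dX (dX (dX u)) x t = _ at e3'
  have e4 := (aux_dt _ _ w φ ψ x t (hcq _)).deriv
  change deriv (fun s => (fun x t => (fun z => (q z : ℂ)) (x + ψ * t) * E x t) x s) t = _ at e4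
  rw [← hu0] at e4
  change dT u x t = _ at e4
  have hEE : E x t * (starRingEnd ℂ) (E x t) = 1 := by
    simp only [hE]
    rw [← Complex.exp_conj, ← Complex.exp_add]
    simp
  rw [e3', e4, e2, e1, hu0]
  change _ * E x t + _ * (_ * E x t) + _ * (_ * E x t) + _ + _ + _ = 0
  simp only [hF2, hF1, map_mul, map_add, Complex.conj_ofReal, Complex.conj_I]
  generalize q (x + ψ * t) = Q
  generalize r (x + ψ * t) = R
  generalize (starRingEnd ℂ) (E x t) = K at *
  generalize E x t = E0 at *
  rw [hψ, hφ, hA2, hc]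
  push_cast
  have hI : Complex.I ^ 2 = -1 := Complex.I_sq
  generalize Complex.I = J at *
  linear_combination
    (E0 * (J * (2 * e * w + 2 * a * A ^ 2) * Q ^ 3
      + (6 * b * A ^ 2 - e) * Q ^ 2 * (R + J * w * Q) + e * Q ^ 2 * (R - J * w * Q))) * hEE
    + (E0 * (2 * a * w * R + J * a * w ^ 2 * Q + 3 * b * w ^ 2 * R + J * b * w ^ 3 * Q)) * hI
end
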